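/- arXiv:1101.5641 — 6 statements merged into one kernel-verified Lean document; each statement's English description precedes it below -/
import Mathlib

section
/- Weight Function Lemma: Let G be a connected simple graph, let r be a vertex of G, and let (T,w) be a strategy rooted at r. If C is an r-unsolvable configuration on G, then w(C) ≤ w(𝐓); that is, ∑_{v ∈ V(G)} w(v)·C(v) ≤ ∑_{v ∈ V(T), v ≠ r} w(v). -/
open Finset SimpleGraph

variable {V : Type*}

/-- A single pebbling move: remove two pebbles from `u` and add one pebble to a
neighbor `v`. -/
def PebblingMove (G : SimpleGraph V) (C C' : V → ℕ) : Prop :=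
  ∃ u v : V, G.Adj u v ∧ 2 ≤ C u ∧
    C' u = C u - 2 ∧ C' v = C v + 1 ∧ ∀ x : V, x ≠ u → x ≠ v → C' x = C x

/-- A configuration `C` is `r`-solvable if some finite sequence of pebbling moves
starting from `C` yields a configuration with at least one pebble on `r`. -/
def PebblingSolvable (G : SimpleGraph V) (r : V) (C : V → ℕ) : Prop :=
  ∃ C' : V → ℕ, Relation.ReflTransGen (PebblingMove G) C C' ∧ 1 ≤ C' r

/-- `piVertex G r` is the least `t` such that every configuration of size `t`
is `r`-solvable. -/
noncomputable def piVertex [Fintype V] (G : SimpleGraph V) (r : V) : ℕ :=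
  sInf {t : ℕ | ∀ C : V → ℕ, (∑ v, C v) = t → PebblingSolvable G r C}

/-- The pebbling number `π(G) = max_r π(G,r)`. -/
noncomputable def pebblingNumber [Fintype V] (G : SimpleGraph V) : ℕ :=
  Finset.univ.sup (fun r => piVertex G r)

/-- A (basic) strategy rooted at `r`: a subtree `T` of `G` containing `r` with
at least two vertices, together with a nonnegative, nonzero weight function `w`
vanishing off `T` and at `r`, with `w(v⁺) = 2·w(v)` for every vertex `v` of `T`
other than `r` and the children of `r`, where `v⁺` is the parent of `v`, i.e.
the neighbor of `v` on the path in `T` from `v` to `r`. -/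
structure Strategy (G : SimpleGraph V) (r : V) where
  T : G.Subgraph
  w : V → ℚ
  root_mem : r ∈ T.verts
  two_le_ncard : 2 ≤ T.verts.ncard
  isTree : T.coe.IsTree
  w_nonneg : ∀ v, 0 ≤ w v
  w_ne_zero : w ≠ 0
  w_outside : ∀ v, v ∉ T.verts → w v = 0
  w_root : w r = 0
  w_parent : ∀ u v : T.verts, T.coe.Adj u v → (v : V) ≠ r → ¬ T.Adj r (v : V) →
    T.coe.dist u ⟨r, root_mem⟩ < T.coe.dist v ⟨r, root_mem⟩ → w (u : V) = 2 * w (v : V)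

/-- `w(C) = ∑_{v ∈ V(G)} w(v)·C(v)`. -/
noncomputable def configWeight [Fintype V] {G : SimpleGraph V} {r : V}
    (S : Strategy G r) (C : V → ℕ) : ℚ :=
  ∑ v, S.w v * (C v : ℚ)

open Classical in
/-- `w(𝐓) = ∑_{v ∈ V(T), v ≠ r} w(v)`. -/
noncomputable def treeWeight [Fintype V] {G : SimpleGraph V} {r : V} (S : Strategy G r) : ℚ :=
  ∑ v ∈ Finset.univ.filter (fun v => v ∈ S.T.verts ∧ v ≠ r), S.w v

theorem SimpleGraph.Connected.exists_adj_dist_lt {W : Type*} {H : SimpleGraph W}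
    (hH : H.Connected) {r v : W} (hv : v ≠ r) : ∃ u, H.Adj u v ∧ H.dist u r < H.dist v r := by
  obtain ⟨p, hp⟩ := hH.exists_walk_length_eq_dist v r
  cases p with
  | nil => exact absurd rfl hv
  | cons h q =>
    refine ⟨_, h.symm, ?_⟩
    rw [← hp, Walk.length_cons]
    exact Nat.lt_succ_of_le (dist_le q)

open Classical in
/-- The configuration obtained from `C` by a pebbling move from `u` to `v`. -/
noncomputable def pebblingStep (C : V → ℕ) (u v : V) : V → ℕ :=
  Function.update (Function.update C u (C u - 2)) v (C v + 1)

theorem pebblingMove_pebblingStep {G : SimpleGraph V} {C : V → ℕ} {u v : V} (h : G.Adj u v)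
    (hu : 2 ≤ C u) : PebblingMove G C (pebblingStep C u v) := by
  refine ⟨u, v, h, hu, ?_, ?_, fun x hxu hxv => ?_⟩
  · simp [pebblingStep, h.ne]
  · simp [pebblingStep]
  · simp [pebblingStep, hxu, hxv]

theorem sum_mul_pebblingStep [Fintype V] {C : V → ℕ} {u v : V} (h : u ≠ v) (hu : 2 ≤ C u)
    (f : V → ℚ) :
    ∑ x, f x * (pebblingStep C u v x : ℚ) = ∑ x, f x * (C x : ℚ) - 2 * f u + f v := by
  classical
  have key (x : V) : f x * (pebblingStep C u v x : ℚ) =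
      f x * (C x : ℚ) - (if x = u then 2 * f x else 0) + (if x = v then f x else 0) := by
    by_cases hxv : x = v
    · subst hxv
      simp [pebblingStep, h.symm]
      ring
    · by_cases hxu : x = u
      · subst hxu
        simp [pebblingStep, h, Nat.cast_sub hu]
        ring
      · simp [pebblingStep, hxu, hxv]
  simp [key, Finset.sum_add_distrib, Finset.sum_sub_distrib]

theorem PebblingSolvable.of_move {G : SimpleGraph V} {r : V} {C C' : V → ℕ}
    (hm : PebblingMove G C C') (h : PebblingSolvable G r C') : PebblingSolvable G r C := by
  obtain ⟨D, hD, hr⟩ := h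
  exact ⟨D, hD.head hm, hr⟩

theorem pebblingSolvable_of_adj {G : SimpleGraph V} {r v : V} {C : V → ℕ} (h : G.Adj v r)
    (hv : 2 ≤ C v) : PebblingSolvable G r C :=
  ⟨_, .single (pebblingMove_pebblingStep h hv), by simp [pebblingStep]⟩

theorem configWeight_le_treeWeight_of_le_one [Fintype V] {G : SimpleGraph V} {r : V}
    (S : Strategy G r) {C : V → ℕ} (hC : ∀ v ∈ S.T.verts, v ≠ r → C v ≤ 1) :
    configWeight S C ≤ treeWeight S := by
  classical
  unfold configWeight treeWeight
  rw [Finset.sum_filter]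
  refine Finset.sum_le_sum fun v _ => ?_
  split_ifs with hv
  · exact mul_le_of_le_one_right (S.w_nonneg v) (by exact_mod_cast hC v hv.1 hv.2)
  · have hw : S.w v = 0 := by
      by_cases hvT : v ∈ S.T.verts
      · obtain rfl : v = r := by tauto
        exact S.w_root
      · exact S.w_outside v hvT
    simp [hw]

/-- **Weight Function Lemma.** If `(T,w)` is a strategy rooted at `r` in a connected
graph `G` and `C` is an `r`-unsolvable configuration, then `w(C) ≤ w(𝐓)`. -/
theorem weight_function_lemma [Fintype V] (G : SimpleGraph V) (hG : G.Connected)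
    (r : V) (S : Strategy G r) (C : V → ℕ) (hC : ¬ PebblingSolvable G r C) :
    configWeight S C ≤ treeWeight S := by
  induction hn : ∑ v, C v using Nat.strong_induction_on generalizing C with
  | _ n ih =>
    by_cases hle : ∀ v ∈ S.T.verts, v ≠ r → C v ≤ 1
    · exact configWeight_le_treeWeight_of_le_one S hle
    push Not at hle
    obtain ⟨v, hvT, hvr, hv⟩ := hle
    have hnadj : ¬ S.T.Adj r v := fun h => hC (pebblingSolvable_of_adj h.adj_sub.symm hv)
    obtain ⟨u, huv, hdist⟩ := S.isTree.connected.exists_adj_dist_lt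
      (r := ⟨r, S.root_mem⟩) (v := ⟨v, hvT⟩) (by simpa using hvr)
    have hadj : G.Adj v u := (S.T.coe_adj_sub _ _ huv).symm
    have hw : S.w u = 2 * S.w v := S.w_parent u ⟨v, hvT⟩ huv hvr hnadj hdist
    have hsize := sum_mul_pebblingStep hadj.ne hv 1
    have hlt : ∑ x, pebblingStep C v u x < n := by
      simp only [Pi.one_apply, one_mul] at hsize
      rw [← hn, ← Nat.cast_lt (α := ℚ)]
      push_cast
      linarith
    have heq : configWeight S (pebblingStep C v u) = configWeight S C := by
      simp only [configWeight]
      rw [sum_mul_pebblingStep hadj.ne hv, hw]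
      ring
    rw [← heq]
    exact ih _ hlt _ (fun h => hC (h.of_move (pebblingMove_pebblingStep hadj hv))) rfl
end

section
/- Pebbling number of trees (Chung's formula): Let T be a tree with root r, viewed as a directed graph with every edge directed toward r, and let 𝒫 be a maximum path partition of T. Then π(T,r) = ∑_{P ∈ 𝒫} 2^{e_P} − |𝒫| + 1, where e_P denotes the number of edges of the path P. -/
open Finset SimpleGraph

variable {V : Type*}

/-- `z` lies on the (unique, in a tree) geodesic from `a` to `b`. -/
def OnGeodesic (G : SimpleGraph V) (a b z : V) : Prop :=
  G.dist a z + G.dist z b = G.dist a b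

/-- The set of edges of `G` lying on the geodesic from `a` to `b`
(in a tree, the edge set of the unique `a`–`b` path). -/
def geodesicEdges (G : SimpleGraph V) (a b : V) : Set (Sym2 V) :=
  {e | e ∈ G.edgeSet ∧ ∀ z ∈ e, OnGeodesic G a b z}

/-- A path partition of the tree `G` rooted at `r`, encoded as a finite set of
ordered pairs `(a,b)`: each pair determines the unique nontrivial path from `a`
to `b`, directed toward `r` (i.e. `b` lies on the path from `a` to `r`); the
paths are pairwise edge-disjoint and their union is all of `G`. -/
def IsPathPartition [Fintype V] (G : SimpleGraph V) (r : V) (P : Finset (V × V)) : Prop :=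
  (∀ p ∈ P, p.1 ≠ p.2) ∧
  (∀ p ∈ P, G.dist p.1 r = G.dist p.1 p.2 + G.dist p.2 r) ∧
  ((P : Set (V × V)).Pairwise fun p q =>
      Disjoint (geodesicEdges G p.1 p.2) (geodesicEdges G q.1 q.2)) ∧
  (⋃ p ∈ (P : Set (V × V)), geodesicEdges G p.1 p.2) = G.edgeSet

/-- The sum of the `k` largest entries of a multiset of naturals. -/
def topSum (s : Multiset ℕ) (k : ℕ) : ℕ :=
  (((s.sort (· ≤ ·)).reverse).take k).sum

/-- One multiset of path lengths majorizes another if every initial partial sum of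
its nonincreasing ordering is at least the corresponding partial sum of the other
(padding with zeros). -/
def Majorizes (s t : Multiset ℕ) : Prop :=
  ∀ k : ℕ, topSum t k ≤ topSum s k

section Geometry

variable {G : SimpleGraph V} {r : V}

open Classical in
/-- The neighbor of `v` that is closer to the root `r`, and `v` itself if there is none. -/
noncomputable def parent (G : SimpleGraph V) (r v : V) : V :=
  if h : ∃ w, G.Adj v w ∧ G.dist v r = G.dist w r + 1 then h.choose else v

lemma exists_adj_dist_eq_add_one (hT : G.IsTree) {a b : V} (h : a ≠ b) :
    ∃ w, G.Adj a w ∧ G.dist a b = G.dist w b + 1 := by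
  obtain ⟨p, hp⟩ := hT.connected.exists_walk_length_eq_dist a b
  cases p with
  | nil => exact absurd rfl h
  | cons hadj q =>
    rename_i w
    refine ⟨w, hadj, ?_⟩
    have h1 := SimpleGraph.dist_le q
    have h2 : G.dist a b ≤ G.dist a w + G.dist w b := hT.connected.dist_triangle
    rw [dist_eq_one_iff_adj.2 hadj] at h2
    simp only [Walk.length_cons] at hp
    omega

lemma eq_of_adj_of_dist_eq_add_one (hT : G.IsTree) {v w w' : V} (h : G.Adj v w)
    (hd : G.dist v r = G.dist w r + 1) (h' : G.Adj v w') (hd' : G.dist v r = G.dist w' r + 1) :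
    w = w' := by
  obtain ⟨p, hp⟩ := hT.connected.exists_walk_length_eq_dist w r
  obtain ⟨q, hq⟩ := hT.connected.exists_walk_length_eq_dist w' r
  have h1 : (Walk.cons h p).IsPath :=
    Walk.isPath_of_length_eq_dist _ (by simp only [Walk.length_cons]; omega)
  have h2 : (Walk.cons h' q).IsPath :=
    Walk.isPath_of_length_eq_dist _ (by simp only [Walk.length_cons]; omega)
  have := (hT.existsUnique_path v r).unique h1 h2
  simp only [Walk.cons.injEq] at this
  exact this.1

lemma adj_parent (hT : G.IsTree) {v : V} (h : v ≠ r) : G.Adj v (parent G r v) := by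
  have h := exists_adj_dist_eq_add_one hT h
  rw [parent, dif_pos h]
  exact h.choose_spec.1

lemma dist_parent (hT : G.IsTree) {v : V} (h : v ≠ r) :
    G.dist v r = G.dist (parent G r v) r + 1 := by
  have h := exists_adj_dist_eq_add_one hT h
  rw [parent, dif_pos h]
  exact h.choose_spec.2

lemma eq_parent (hT : G.IsTree) {v w : V} (h : G.Adj v w)
    (hd : G.dist v r = G.dist w r + 1) : w = parent G r v := by
  have hv : v ≠ r := by rintro rfl; simp at hd
  exact eq_of_adj_of_dist_eq_add_one hT h hd (adj_parent hT hv) (dist_parent hT hv)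

/-- Every edge joins a non-root vertex to its parent. -/
lemma adj_eq_parent (hT : G.IsTree) {v w : V} (h : G.Adj v w) :
    (v ≠ r ∧ w = parent G r v) ∨ (w ≠ r ∧ v = parent G r w) := by
  rcases hT.dist_eq_dist_add_one_of_adj r h with hd | hd
  · rw [dist_comm, dist_comm (u := r)] at hd
    exact Or.inl ⟨by rintro rfl; simp at hd, eq_parent hT h hd⟩
  · rw [dist_comm, dist_comm (u := r)] at hd
    exact Or.inr ⟨by rintro rfl; simp at hd, eq_parent hT h.symm hd⟩

/-- `b` lies on the path from `a` to the root. -/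
def IsRootward (G : SimpleGraph V) (r a b : V) : Prop :=
  G.dist a r = G.dist a b + G.dist b r

lemma dist_iterate_parent_root (hT : G.IsTree) {a : V} {k : ℕ} (hk : k ≤ G.dist a r) :
    G.dist a r = k + G.dist ((parent G r)^[k] a) r := by
  induction k with
  | zero => simp
  | succ k ih =>
    have h := ih (by omega)
    have hne : (parent G r)^[k] a ≠ r := by
      intro he
      rw [he] at h
      simp at h
      omega
    rw [Function.iterate_succ_apply', h, dist_parent hT hne]
    omega

lemma iterate_parent_ne_root (hT : G.IsTree) {a : V} {k : ℕ} (hk : k < G.dist a r) :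
    (parent G r)^[k] a ≠ r := by
  intro he
  have := dist_iterate_parent_root hT hk.le
  rw [he] at this
  simp at this
  omega

lemma dist_iterate_parent (hT : G.IsTree) {a : V} {k : ℕ} (hk : k ≤ G.dist a r) :
    G.dist a ((parent G r)^[k] a) = k := by
  have hle : ∀ j ≤ G.dist a r, G.dist a ((parent G r)^[j] a) ≤ j := by
    intro j
    induction j with
    | zero => simp
    | succ j ih =>
      intro hj
      have h1 : G.dist ((parent G r)^[j] a) ((parent G r)^[j + 1] a) = 1 := by
        rw [Function.iterate_succ_apply', dist_eq_one_iff_adj]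
        exact adj_parent hT (iterate_parent_ne_root hT (Nat.lt_of_succ_le hj))
      have h2 : G.dist a ((parent G r)^[j + 1] a) ≤ G.dist a ((parent G r)^[j] a) +
        G.dist ((parent G r)^[j] a) ((parent G r)^[j + 1] a) := hT.connected.dist_triangle
      have := ih (by omega)
      omega
  have h1 := dist_iterate_parent_root hT hk
  have h2 : G.dist a r ≤ G.dist a ((parent G r)^[k] a) + G.dist ((parent G r)^[k] a) r :=
    hT.connected.dist_triangle
  have := hle k hk
  omega

lemma isRootward_iterate_parent (hT : G.IsTree) {a : V} {k : ℕ} (hk : k ≤ G.dist a r) :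
    IsRootward G r a ((parent G r)^[k] a) := by
  rw [IsRootward, dist_iterate_parent hT hk]
  exact dist_iterate_parent_root hT hk

lemma IsRootward.eq_iterate_parent (hT : G.IsTree) {a b : V} (h : IsRootward G r a b) :
    b = (parent G r)^[G.dist a b] a := by
  generalize hk : G.dist a b = k
  induction k generalizing a with
  | zero => exact (hT.connected.dist_eq_zero_iff.1 hk).symm
  | succ k ih =>
    have hne : a ≠ b := by rintro rfl; simp at hk
    obtain ⟨w, hw, hd⟩ := exists_adj_dist_eq_add_one hT hne
    have h1 : G.dist w r ≤ G.dist w b + G.dist b r := hT.connected.dist_triangle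
    have h2 : G.dist a r ≤ G.dist a w + G.dist w r := hT.connected.dist_triangle
    rw [dist_eq_one_iff_adj.2 hw] at h2
    rw [IsRootward] at h
    have h3 := eq_parent (r := r) hT hw (by omega)
    rw [Function.iterate_succ_apply, ← h3]
    exact ih (by rw [IsRootward]; omega) (by omega)

lemma IsRootward.dist_le {a b : V} (h : IsRootward G r a b) : G.dist a b ≤ G.dist a r := by
  rw [IsRootward] at h
  omega

lemma IsRootward.onGeodesic_iff (hT : G.IsTree) {a b z : V} (h : IsRootward G r a b) :
    OnGeodesic G a b z ↔ ∃ i ≤ G.dist a b, z = (parent G r)^[i] a := by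
  have hle := h.dist_le
  have hb := h.eq_iterate_parent hT
  rw [IsRootward] at h
  constructor
  · intro hz
    rw [OnGeodesic] at hz
    have h1 : G.dist z r ≤ G.dist z b + G.dist b r := hT.connected.dist_triangle
    have h2 : G.dist a r ≤ G.dist a z + G.dist z r := hT.connected.dist_triangle
    refine ⟨G.dist a z, by omega, IsRootward.eq_iterate_parent hT ?_⟩
    rw [IsRootward]
    omega
  · rintro ⟨i, hi, rfl⟩
    have h1 := dist_iterate_parent_root hT (hi.trans hle)
    have h3 : (parent G r)^[G.dist a b - i] ((parent G r)^[i] a) = b := by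
      rw [← Function.iterate_add_apply, Nat.sub_add_cancel hi, ← hb]
    have h2 := dist_iterate_parent (r := r) hT (a := (parent G r)^[i] a) (k := G.dist a b - i)
      (by omega)
    rw [h3] at h2
    rw [OnGeodesic, dist_iterate_parent hT (hi.trans hle)]
    omega

/-- The edges on a directed path are those joining a non-final vertex to its parent. -/
lemma IsRootward.mem_geodesicEdges_iff (hT : G.IsTree) {a b v : V} (h : IsRootward G r a b)
    (hv : v ≠ r) :
    s(v, parent G r v) ∈ geodesicEdges G a b ↔ ∃ i < G.dist a b, v = (parent G r)^[i] a := by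
  have hle := h.dist_le
  constructor
  · rintro ⟨-, hz⟩
    obtain ⟨i, hi, hvi⟩ := (h.onGeodesic_iff hT).1 (hz v (by simp))
    obtain ⟨j, hj, hpj⟩ := (h.onGeodesic_iff hT).1 (hz (parent G r v) (by simp))
    have h1 := dist_iterate_parent_root hT (hi.trans hle)
    have h2 := dist_iterate_parent_root hT (hj.trans hle)
    rw [← hvi] at h1
    rw [← hpj] at h2
    have := dist_parent hT hv
    exact ⟨i, by omega, hvi⟩
  · rintro ⟨i, hi, rfl⟩
    refine ⟨adj_parent hT hv, fun z hz => (h.onGeodesic_iff hT).2 ?_⟩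
    rcases Sym2.mem_iff.1 hz with rfl | rfl
    · exact ⟨i, hi.le, rfl⟩
    · exact ⟨i + 1, hi, (Function.iterate_succ_apply' _ _ _).symm⟩

lemma mem_edgeSet_eq_parent (hT : G.IsTree) {e : Sym2 V} (he : e ∈ G.edgeSet) :
    ∃ v ≠ r, e = s(v, parent G r v) := by
  induction e with
  | h v w =>
    rcases adj_eq_parent (r := r) hT (mem_edgeSet G |>.1 he) with ⟨hv, h⟩ | ⟨hw, h⟩
    · exact ⟨v, hv, h ▸ rfl⟩
    · exact ⟨w, hw, h ▸ Sym2.eq_swap⟩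

/-- A set of directed pairs is a path partition iff each non-root vertex is a non-final
vertex of exactly one of the paths. -/
lemma isPathPartition_iff [Fintype V] (hT : G.IsTree) {P : Finset (V × V)} :
    IsPathPartition G r P ↔ (∀ p ∈ P, p.1 ≠ p.2) ∧ (∀ p ∈ P, IsRootward G r p.1 p.2) ∧
      ∀ v ≠ r, ∃! p, p ∈ P ∧ ∃ i < G.dist p.1 p.2, v = (parent G r)^[i] p.1 := by
  unfold IsPathPartition
  refine and_congr_right fun _ => and_congr_right fun (hd : ∀ p ∈ P, IsRootward G r p.1 p.2) => ?_
  constructor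
  · rintro ⟨hdis, hun⟩ v hv
    have hmem : s(v, parent G r v) ∈ G.edgeSet := adj_parent hT hv
    rw [← hun] at hmem
    simp only [Set.mem_iUnion, Finset.mem_coe, exists_prop] at hmem
    obtain ⟨p, hp, hvp⟩ := hmem
    refine ⟨p, ⟨hp, ((hd p hp).mem_geodesicEdges_iff hT hv).1 hvp⟩, fun q ⟨hq, hvq⟩ => ?_⟩
    by_contra hne
    exact Set.disjoint_left.1 (hdis hq hp hne)
      (((hd q hq).mem_geodesicEdges_iff hT hv).2 hvq) hvp
  · intro h
    refine ⟨fun p hp q hq hne => Set.disjoint_left.2 fun e hep heq => ?_, ?_⟩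
    · obtain ⟨v, hv, rfl⟩ := mem_edgeSet_eq_parent (r := r) hT hep.1
      exact hne ((h v hv).unique ⟨hp, ((hd p hp).mem_geodesicEdges_iff hT hv).1 hep⟩
        ⟨hq, ((hd q hq).mem_geodesicEdges_iff hT hv).1 heq⟩)
    · refine Set.Subset.antisymm (Set.iUnion₂_subset fun p _ e he => he.1) fun e he => ?_
      obtain ⟨v, hv, rfl⟩ := mem_edgeSet_eq_parent (r := r) hT he
      obtain ⟨p, ⟨hp, hvp⟩, -⟩ := h v hv
      exact Set.mem_iUnion₂.2 ⟨p, hp, ((hd p hp).mem_geodesicEdges_iff hT hv).2 hvp⟩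

end Geometry

section Height

variable [Fintype V] {G : SimpleGraph V} {r : V}

open Classical in
/-- The length of a longest directed path ending at `v`. -/
noncomputable def height (G : SimpleGraph V) (r v : V) : ℕ :=
  (univ.filter fun u => IsRootward G r u v).sup fun u => G.dist u v

lemma IsRootward.dist_le_height {u v : V} (h : IsRootward G r u v) :
    G.dist u v ≤ height G r v := by
  classical
  exact Finset.le_sup (f := fun u => G.dist u v) (mem_filter.2 ⟨mem_univ _, h⟩)

lemma exists_isRootward_dist_eq_height (v : V) :
    ∃ u, IsRootward G r u v ∧ G.dist u v = height G r v := by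
  classical
  obtain ⟨u, hu, h⟩ := Finset.exists_mem_eq_sup (univ.filter fun u => IsRootward G r u v)
    ⟨v, mem_filter.2 ⟨mem_univ _, by simp [IsRootward]⟩⟩ (fun u => G.dist u v)
  exact ⟨u, (mem_filter.1 hu).2, h.symm⟩

lemma height_add_one_le_height_parent (hT : G.IsTree) {v : V} (hv : v ≠ r) :
    height G r v + 1 ≤ height G r (parent G r v) := by
  obtain ⟨u, hu, h⟩ := exists_isRootward_dist_eq_height (G := G) (r := r) v
  have h1 : G.dist u (parent G r v) ≤ G.dist u v + G.dist v (parent G r v) :=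
    hT.connected.dist_triangle
  rw [dist_eq_one_iff_adj.2 (adj_parent hT hv)] at h1
  have h2 : G.dist u r ≤ G.dist u (parent G r v) + G.dist (parent G r v) r :=
    hT.connected.dist_triangle
  have h3 := dist_parent hT hv
  have h4 := hu
  rw [IsRootward] at h4
  have h5 : IsRootward G r u (parent G r v) := by
    rw [IsRootward]
    omega
  have := h5.dist_le_height
  omega

lemma exists_child_height (hT : G.IsTree) {v : V} (hv : height G r v ≠ 0) :
    ∃ c, c ≠ r ∧ parent G r c = v ∧ height G r c + 1 = height G r v := by
  obtain ⟨u, hu, h⟩ := exists_isRootward_dist_eq_height (G := G) (r := r) v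
  obtain ⟨k, hk⟩ : ∃ k, G.dist u v = k + 1 := ⟨G.dist u v - 1, by omega⟩
  have hle := hu.dist_le
  have heq := hu.eq_iterate_parent hT
  rw [hk, Function.iterate_succ_apply'] at heq
  have hc := iterate_parent_ne_root hT (a := u) (r := r) (k := k) (by omega)
  have h1 := (isRootward_iterate_parent hT (a := u) (r := r) (k := k) (by omega)).dist_le_height
  rw [dist_iterate_parent hT (by omega)] at h1
  have h2 := height_add_one_le_height_parent hT hc
  rw [← heq] at h2
  exact ⟨_, hc, heq.symm, by omega⟩

end Height

section Solvability

variable {G : SimpleGraph V} {r : V}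

open Classical in
/-- If the number of pebbles that can be collected on each vertex is bounded in a way that
leaves no pebble for the root, then the configuration is unsolvable. -/
lemma not_pebblingSolvable_of_bound [Fintype V] (hT : G.IsTree) {C g : V → ℕ} (hr : g r = 0)
    (hg : ∀ v, C v + ∑ c with c ≠ r ∧ parent G r c = v, g c / 2 ≤ g v) :
    ¬ PebblingSolvable G r C := by
  rintro ⟨C', hC', h1⟩
  suffices ∃ g : V → ℕ, g r = 0 ∧
      ∀ v, C' v + ∑ c with c ≠ r ∧ parent G r c = v, g c / 2 ≤ g v by
    obtain ⟨g, hr, hg⟩ := this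
    have := hg r
    omega
  clear h1
  induction hC' with
  | refl => exact ⟨g, hr, hg⟩
  | tail _ hmove ih =>
    rename_i D D' _
    obtain ⟨g, hr, hg⟩ := ih
    obtain ⟨u, v, hadj, h2, hu, hv, hx⟩ := hmove
    have hne := hadj.ne
    have hur : u ≠ r := by
      rintro rfl
      have := hg u
      omega
    have hgu : 2 ≤ g u := by
      have := hg u
      omega
    rcases adj_eq_parent (r := r) hT hadj with ⟨-, hpar⟩ | ⟨hvr, hpar⟩
    · refine ⟨Function.update g u (g u - 2), by simp [hur.symm, hr], fun x => ?_⟩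
      have hle : ∀ c, Function.update g u (g u - 2) c / 2 ≤ g c / 2 := by
        intro c
        by_cases hc : c = u
        · subst hc; simp; omega
        · simp [hc]
      have hsum : ∑ c with c ≠ r ∧ parent G r c = x, Function.update g u (g u - 2) c / 2 ≤
          ∑ c with c ≠ r ∧ parent G r c = x, g c / 2 := sum_le_sum fun c _ => hle c
      have hgx := hg x
      by_cases hxu : x = u
      · subst hxu
        simp only [Function.update_self]
        omega
      · rw [Function.update_of_ne hxu]
        by_cases hxv : x = v
        · subst hxv
          have : ∑ c with c ≠ r ∧ parent G r c = x, Function.update g u (g u - 2) c / 2 <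
              ∑ c with c ≠ r ∧ parent G r c = x, g c / 2 :=
            sum_lt_sum (fun c _ => hle c)
              ⟨u, mem_filter.2 ⟨mem_univ _, hur, hpar.symm⟩, by
                simp only [Function.update_self]; omega⟩
          omega
        · rw [hx x hxu hxv]
          omega
    · refine ⟨Function.update g v (g v + 1), by simp [hvr.symm, hr], fun x => ?_⟩
      have hgx := hg x
      by_cases hxu : x = u
      · subst hxu
        rw [Function.update_of_ne hne]
        have hmem : v ∈ univ.filter fun c => c ≠ r ∧ parent G r c = x :=
          mem_filter.2 ⟨mem_univ _, hvr, hpar.symm⟩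
        rw [← add_sum_erase _ _ hmem] at hgx ⊢
        have : ∑ c ∈ (univ.filter fun c => c ≠ r ∧ parent G r c = x).erase v,
            Function.update g v (g v + 1) c / 2 =
            ∑ c ∈ (univ.filter fun c => c ≠ r ∧ parent G r c = x).erase v, g c / 2 :=
          sum_congr rfl fun c hc => by rw [Function.update_of_ne (ne_of_mem_erase hc)]
        rw [this, Function.update_self]
        omega
      · have : ∑ c with c ≠ r ∧ parent G r c = x, Function.update g v (g v + 1) c / 2 =
            ∑ c with c ≠ r ∧ parent G r c = x, g c / 2 := by
          refine sum_congr rfl fun c hc => ?_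
          rw [Function.update_of_ne]
          rintro rfl
          exact hxu ((mem_filter.1 hc).2.2.symm.trans hpar.symm)
        rw [this]
        by_cases hxv : x = v
        · subst hxv
          rw [Function.update_self]
          omega
        · rw [Function.update_of_ne hxv, hx x hxu hxv]
          exact hgx

open Classical in
/-- A configuration is solvable as soon as its size, with a pebble on `v` counted
`2 ^ height v` times, exceeds the total weight of the non-root vertices. -/
lemma pebblingSolvable_of_lt_weight [Fintype V] (hT : G.IsTree) {C : V → ℕ}
    (hC : ∑ v with v ≠ r, 2 ^ height G r v < ∑ v, 2 ^ height G r v * C v) :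
    PebblingSolvable G r C := by
  generalize hn : ∑ v, C v = n
  induction n using Nat.strong_induction_on generalizing C with
  | _ n ih =>
    by_cases hr : 1 ≤ C r
    · exact ⟨C, .refl, hr⟩
    obtain ⟨u, hur, hu⟩ : ∃ u, u ≠ r ∧ 2 ≤ C u := by
      by_contra! hcon
      refine hC.not_ge ?_
      rw [sum_filter]
      refine sum_le_sum fun v _ => ?_
      by_cases hv : v = r
      · subst hv
        simp [Nat.lt_one_iff.1 (not_le.1 hr)]
      · rw [if_pos hv]
        have := hcon v hv
        exact (Nat.mul_le_mul_left _ (by omega)).trans_eq (mul_one _)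
    set p := parent G r u with hp
    have hadj : G.Adj u p := adj_parent hT hur
    have hne := hadj.ne
    set D : V → ℕ := Function.update (Function.update C u (C u - 2)) p (C p + 1) with hD
    have hDu : D u = C u - 2 := by simp [hD, hne]
    have hDp : D p = C p + 1 := by simp [hD]
    have hDx : ∀ x, x ≠ u → x ≠ p → D x = C x := fun x h1 h2 => by simp [hD, h1, h2]
    have hsplit : ∀ f : V → ℕ, ∑ v, f v = f u + (f p + ∑ v ∈ (univ.erase u).erase p, f v) := by
      intro f
      rw [add_sum_erase _ _ (mem_erase.2 ⟨hne.symm, mem_univ _⟩), add_sum_erase _ _ (mem_univ _)]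
    have hrest : ∀ w : V → ℕ, ∑ v ∈ (univ.erase u).erase p, w v * D v =
        ∑ v ∈ (univ.erase u).erase p, w v * C v := fun w => by
      refine sum_congr rfl fun v hv => ?_
      simp only [mem_erase, mem_univ, and_true] at hv
      rw [hDx v hv.2 hv.1]
    have hmove : PebblingMove G C D := ⟨u, p, hadj, hu, hDu, hDp, hDx⟩
    have hsize : ∑ v, D v < n := by
      have h := hrest 1
      simp only [Pi.one_apply, one_mul] at h
      rw [hsplit] at hn
      rw [hsplit, hDu, hDp, h]
      omega
    have hweight : ∑ v, 2 ^ height G r v * C v ≤ ∑ v, 2 ^ height G r v * D v := by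
      rw [hsplit, hsplit (fun v => 2 ^ height G r v * D v), hDu, hDp, hrest]
      have h1 : 2 ^ (height G r u + 1) ≤ 2 ^ height G r p :=
        Nat.pow_le_pow_right two_pos (height_add_one_le_height_parent hT hur)
      obtain ⟨m, hm⟩ := Nat.exists_eq_add_of_le hu
      rw [hm, Nat.add_sub_cancel_left]
      rw [pow_succ] at h1
      nlinarith
    obtain ⟨E, hE, hEr⟩ := ih _ hsize (hC.trans_le hweight) rfl
    exact ⟨E, .head hmove hE, hEr⟩

lemma PebblingSolvable.mono {C D : V → ℕ} (h : PebblingSolvable G r C) (hCD : C ≤ D) :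
    PebblingSolvable G r D := by
  obtain ⟨C', hC', hr⟩ := h
  suffices ∃ D', Relation.ReflTransGen (PebblingMove G) D D' ∧ C' ≤ D' by
    obtain ⟨D', h1, h2⟩ := this
    exact ⟨D', h1, hr.trans (h2 r)⟩
  clear hr
  induction hC' with
  | refl => exact ⟨D, .refl, hCD⟩
  | tail _ hmove ih =>
    rename_i A B _
    classical
    obtain ⟨D', h1, h2⟩ := ih
    obtain ⟨u, v, hadj, hu, hBu, hBv, hx⟩ := hmove
    have hne := hadj.ne
    refine ⟨Function.update (Function.update D' u (D' u - 2)) v (D' v + 1), h1.tail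
      ⟨u, v, hadj, hu.trans (h2 u), by simp [hne], by simp,
        fun x hxu hxv => by simp [hxu, hxv]⟩, fun x => ?_⟩
    have hux : A u ≤ D' u := h2 u
    have hvx : A v ≤ D' v := h2 v
    by_cases hxv : x = v
    · subst hxv
      rw [Function.update_self, hBv]
      exact Nat.add_le_add_right hvx 1
    · by_cases hxu : x = u
      · subst hxu
        rw [Function.update_of_ne hxv, Function.update_self, hBu]
        exact Nat.sub_le_sub_right hux 2
      · simp [hxu, hxv, hx, h2 x]

end Solvability

section Majorization

lemma sum_map_sub_add_mul_le_of_sorted (j : ℕ) {l : List ℕ} (hl : l.Pairwise (· ≥ ·)) :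
    ∃ k, (l.map (· - j)).sum + k * j ≤ (l.take k).sum := by
  induction l with
  | nil => exact ⟨0, by simp⟩
  | cons a l ih =>
    rw [List.pairwise_cons] at hl
    by_cases ha : j < a
    · obtain ⟨k, hk⟩ := ih hl.2
      refine ⟨k + 1, ?_⟩
      simp only [List.map_cons, List.sum_cons, List.take_succ_cons, add_mul, one_mul]
      omega
    · refine ⟨0, ?_⟩
      have : ∀ x ∈ (a :: l).map (· - j), x = 0 := by
        simp only [List.mem_map, List.mem_cons]
        rintro _ ⟨x, rfl | hx, rfl⟩
        · omega
        · have := hl.1 x hx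
          omega
      rw [List.sum_eq_zero this]
      simp

lemma sum_take_le_sum_map_sub_add_mul (j k : ℕ) (l : List ℕ) :
    (l.take k).sum ≤ (l.map (· - j)).sum + k * j := by
  induction l generalizing k with
  | nil => simp
  | cons a l ih =>
    cases k with
    | zero => simp
    | succ k =>
      have := ih k
      simp only [List.map_cons, List.sum_cons, List.take_succ_cons, add_mul, one_mul]
      omega

lemma Majorizes.sum_map_sub_le {s t : Multiset ℕ} (h : Majorizes s t) (j : ℕ) :
    (t.map (· - j)).sum ≤ (s.map (· - j)).sum := by
  have hmap : ∀ u : Multiset ℕ,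
      (u.map (· - j)).sum = (((u.sort (· ≤ ·)).reverse).map (· - j)).sum := by
    intro u
    rw [← Multiset.sum_coe, ← Multiset.map_coe, Multiset.coe_reverse, Multiset.sort_eq]
  obtain ⟨k, hk⟩ := sum_map_sub_add_mul_le_of_sorted j (l := (t.sort (· ≤ ·)).reverse)
    (List.pairwise_reverse.2 (Multiset.pairwise_sort _ _))
  have h1 := h k
  have h2 := sum_take_le_sum_map_sub_add_mul j k (s.sort (· ≤ ·)).reverse
  rw [hmap, hmap]
  rw [topSum, topSum] at h1
  omega

lemma two_pow_eq_sum_sub {x n : ℕ} (h : x ≤ n) :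
    2 ^ x - 1 = x + ∑ j ∈ range n, 2 ^ j * (x - (j + 1)) := by
  have hgeom : ∀ x, 2 ^ x = 1 + x + ∑ j ∈ range x, 2 ^ j * (x - (j + 1)) := by
    intro x
    induction x with
    | zero => simp
    | succ x ih =>
      have h1 : ∑ j ∈ range (x + 1), 2 ^ j * (x + 1 - (j + 1)) =
          ∑ j ∈ range x, 2 ^ j * (x - (j + 1)) + ∑ j ∈ range x, 2 ^ j := by
        rw [sum_range_succ, Nat.sub_self, mul_zero, add_zero, ← sum_add_distrib]
        refine sum_congr rfl fun j hj => ?_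
        have := mem_range.1 hj
        rw [show x + 1 - (j + 1) = x - (j + 1) + 1 by omega]
        ring
      have h2 : ∑ j ∈ range x, 2 ^ j + 1 = 2 ^ x := by
        simpa using geom_sum_mul_add (1 : ℕ) x
      rw [h1, pow_succ]
      omega
  have hsub : ∑ j ∈ range x, 2 ^ j * (x - (j + 1)) = ∑ j ∈ range n, 2 ^ j * (x - (j + 1)) := by
    refine sum_subset (range_mono h) fun j _ hj => ?_
    rw [mem_range, not_lt] at hj
    rw [Nat.sub_eq_zero_of_le (by omega), mul_zero]
  rw [← hsub, hgeom x]
  omega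

lemma Majorizes.sum_two_pow_sub_one_le {s t : Multiset ℕ} (h : Majorizes s t) :
    (t.map (2 ^ · - 1)).sum ≤ (s.map (2 ^ · - 1)).sum := by
  have hexp : ∀ u : Multiset ℕ, (∀ x ∈ u, x ≤ s.sum + t.sum) → (u.map (2 ^ · - 1)).sum =
      (u.map (· - 0)).sum +
        ∑ j ∈ range (s.sum + t.sum), 2 ^ j * (u.map (· - (j + 1))).sum := by
    intro u hu
    rw [Multiset.map_congr rfl fun x hx => two_pow_eq_sum_sub (hu x hx), Multiset.sum_map_add]
    simp only [Nat.sub_zero, Multiset.sum_map_sum, Multiset.sum_map_mul_left]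
  rw [hexp t fun x hx => (Multiset.le_sum_of_mem hx).trans (Nat.le_add_left _ _),
    hexp s fun x hx => (Multiset.le_sum_of_mem hx).trans (Nat.le_add_right _ _)]
  exact add_le_add (h.sum_map_sub_le 0)
    (sum_le_sum fun j _ => Nat.mul_le_mul_left _ (h.sum_map_sub_le (j + 1)))

end Majorization

section PathPartition

variable [Fintype V] {G : SimpleGraph V} {r : V}

/-- Every path partition yields an unsolvable configuration, placing `2 ^ e - 1` pebbles at
the start of each path with `e` edges. -/
lemma IsPathPartition.exists_not_pebblingSolvable (hT : G.IsTree) {P : Finset (V × V)}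
    (hP : IsPathPartition G r P) :
    ∃ C : V → ℕ, ∑ v, C v = ∑ p ∈ P, (2 ^ G.dist p.1 p.2 - 1) ∧ ¬ PebblingSolvable G r C := by
  classical
  obtain ⟨hne, hdir, huniq⟩ := (isPathPartition_iff hT).1 hP
  choose! q hq hqu using fun v (hv : v ≠ r) => (huniq v hv)
  choose! i hi hvi using fun v (hv : v ≠ r) => (hq v hv).2
  replace hq := fun v (hv : v ≠ r) => (hq v hv).1
  have hpos : ∀ p ∈ P, 0 < G.dist p.1 p.2 := fun p hp => hT.connected.pos_dist_of_ne (hne p hp)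
  have hle : ∀ p ∈ P, G.dist p.1 p.2 ≤ G.dist p.1 r := fun p hp => (hdir p hp).dist_le
  have hdist : ∀ p ∈ P, ∀ j < G.dist p.1 p.2,
      G.dist p.1 r = j + G.dist ((parent G r)^[j] p.1) r := fun p hp j hj =>
    dist_iterate_parent_root hT (hj.le.trans (hle p hp))
  have hidx : ∀ p ∈ P, ∀ j < G.dist p.1 p.2, ∀ v ≠ r, v = (parent G r)^[j] p.1 →
      p = q v ∧ j = i v := by
    intro p hp j hj v hv hvj
    have hpq : p = q v := hqu v hv p ⟨hp, j, hj, hvj⟩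
    refine ⟨hpq, ?_⟩
    have h1 := hdist p hp j hj
    have h2 := hdist (q v) (hq v hv) (i v) (hi v hv)
    rw [← hvj] at h1
    rw [← hvi v hv, ← hpq] at h2
    omega
  refine ⟨fun v => ∑ p ∈ P with p.1 = v, (2 ^ G.dist p.1 p.2 - 1),
    sum_fiberwise P Prod.fst _, ?_⟩
  refine not_pebblingSolvable_of_bound hT
    (g := fun v => if v = r then 0 else 2 ^ (G.dist (q v).1 (q v).2 - i v) - 1) (if_pos rfl)
    fun v => ?_
  by_cases hv : v = r
  · subst hv
    rw [if_pos rfl, Nat.le_zero, Nat.add_eq_zero_iff]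
    refine ⟨sum_eq_zero fun p hp => ?_, sum_eq_zero fun c hc => ?_⟩
    · obtain ⟨hpP, rfl⟩ := mem_filter.1 hp
      have h1 := hpos p hpP
      have h2 := hle p hpP
      rw [SimpleGraph.dist_self] at h2
      omega
    · obtain ⟨-, hcr, hcp⟩ := mem_filter.1 hc
      rw [if_neg hcr]
      have h1 := hdist (q c) (hq c hcr) (i c) (hi c hcr)
      rw [← hvi c hcr, dist_parent hT hcr, hcp, SimpleGraph.dist_self] at h1
      have h2 := hle _ (hq c hcr)
      have h3 := hi c hcr
      rw [show G.dist (q c).1 (q c).2 - i c = 1 by omega]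
      norm_num
  · rw [if_neg hv]
    have hchild : ∀ c, c ≠ r → parent G r c = v →
        i c + 1 < G.dist (q c).1 (q c).2 → q c = q v ∧ i c + 1 = i v := by
      intro c hcr hcp hlt
      refine hidx (q c) (hq c hcr) (i c + 1) hlt v hv ?_
      rw [Function.iterate_succ_apply', ← hvi c hcr, hcp]
    have hsmall : ∀ c, c ≠ r → ¬ i c + 1 < G.dist (q c).1 (q c).2 →
        (2 ^ (G.dist (q c).1 (q c).2 - i c) - 1) / 2 = 0 := by
      intro c hcr hlt
      have := hi c hcr
      rw [show G.dist (q c).1 (q c).2 - i c = 1 by omega]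
      norm_num
    by_cases hiv : i v = 0
    · have h1 : ∑ p ∈ P with p.1 = v, (2 ^ G.dist p.1 p.2 - 1) ≤
          2 ^ G.dist (q v).1 (q v).2 - 1 := by
        refine (sum_le_sum_of_subset (t := {q v}) fun p hp => ?_).trans_eq (sum_singleton _ _)
        obtain ⟨hpP, rfl⟩ := mem_filter.1 hp
        exact mem_singleton.2 (hidx p hpP 0 (hpos p hpP) p.1 hv rfl).1
      have h2 : ∑ c with c ≠ r ∧ parent G r c = v,
          (if c = r then 0 else 2 ^ (G.dist (q c).1 (q c).2 - i c) - 1) / 2 = 0 := by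
        refine sum_eq_zero fun c hc => ?_
        obtain ⟨-, hcr, hcp⟩ := mem_filter.1 hc
        rw [if_neg hcr]
        refine hsmall c hcr fun hlt => ?_
        have := (hchild c hcr hcp hlt).2
        omega
      rw [h2, hiv]
      exact h1
    · have h1 : ∑ p ∈ P with p.1 = v, (2 ^ G.dist p.1 p.2 - 1) = 0 := by
        refine sum_eq_zero fun p hp => ?_
        obtain ⟨hpP, rfl⟩ := mem_filter.1 hp
        exact absurd (hidx p hpP 0 (hpos p hpP) p.1 hv rfl).2.symm hiv
      rw [h1, zero_add]
      have hterm : ∀ c ∈ univ.filter (fun c => c ≠ r ∧ parent G r c = v),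
          (if c = r then 0 else 2 ^ (G.dist (q c).1 (q c).2 - i c) - 1) / 2 ≤
          if c = (parent G r)^[i v - 1] (q v).1 then
            2 ^ (G.dist (q v).1 (q v).2 - i v) - 1 else 0 := by
        intro c hc
        obtain ⟨-, hcr, hcp⟩ := mem_filter.1 hc
        rw [if_neg hcr]
        by_cases hlt : i c + 1 < G.dist (q c).1 (q c).2
        · obtain ⟨h2, h3⟩ := hchild c hcr hcp hlt
          have h4 : c = (parent G r)^[i v - 1] (q v).1 := by
            rw [← h3, ← h2, Nat.add_sub_cancel]
            exact hvi c hcr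
          rw [if_pos h4, ← h2, ← h3,
            show G.dist (q c).1 (q c).2 - i c = G.dist (q c).1 (q c).2 - (i c + 1) + 1 by omega,
            pow_succ]
          omega
        · rw [hsmall c hcr hlt]
          exact Nat.zero_le _
      refine (sum_le_sum hterm).trans ?_
      rw [sum_ite_eq']
      split_ifs
      · exact le_rfl
      · exact Nat.zero_le _

/-- Decomposing the tree into longest paths gives a path partition whose weight
`∑ (2 ^ e - 1)` is at least the sum of `2 ^ height v` over the non-root vertices. -/
lemma exists_isPathPartition_weight (hT : G.IsTree) :
    ∃ Q : Finset (V × V), IsPathPartition G r Q ∧ ∀ s : Finset V, (∀ v, v ∈ s ↔ v ≠ r) →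
      ∑ v ∈ s, 2 ^ height G r v ≤ ∑ p ∈ Q, (2 ^ G.dist p.1 p.2 - 1) := by
  classical
  choose! c hcr hcp hch using fun v (hv : height G r v ≠ 0) => exists_child_height hT hv
  have hheight : ∀ v, ∀ m ≤ height G r v, height G r (c^[m] v) + m = height G r v := by
    intro v m
    induction m with
    | zero => simp
    | succ m ih =>
      intro hm
      have h1 := ih (by omega)
      have h2 := hch (c^[m] v) (by omega)
      rw [Function.iterate_succ_apply']
      omega
  have hparent : ∀ v, ∀ m ≤ height G r v, ∀ j ≤ m,
      (parent G r)^[j] (c^[m] v) = c^[m - j] v := by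
    intro v m hm j
    induction j with
    | zero => simp
    | succ j ih =>
      intro hj
      have h1 := hheight v (m - (j + 1)) (by omega)
      rw [Function.iterate_succ_apply', ih (by omega), show m - j = m - (j + 1) + 1 by omega,
        Function.iterate_succ_apply', hcp _ (by omega)]
  have hroot : ∀ v ≠ r, ∀ m ≤ height G r v, c^[m] v ≠ r := by
    intro v hv m hm
    cases m with
    | zero => exact hv
    | succ m =>
      have h1 := hheight v m (by omega)
      rw [Function.iterate_succ_apply']
      exact hcr _ (by omega)
  have hdepth : ∀ v ≠ r, ∀ m ≤ height G r v, G.dist (c^[m] v) r = G.dist v r + m := by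
    intro v hv m
    induction m with
    | zero => simp
    | succ m ih =>
      intro hm
      have h1 := hheight v m (by omega)
      rw [Function.iterate_succ_apply', dist_parent hT (hcr _ (by omega)), hcp _ (by omega),
        ih (by omega), add_assoc]
  let top : V → Prop := fun v => v ≠ r ∧ ¬ (parent G r v ≠ r ∧ c (parent G r v) = v)
  let path : V → V × V := fun v => (c^[height G r v] v, parent G r v)
  have hend : ∀ v ≠ r, parent G r v = (parent G r)^[height G r v + 1] (path v).1 := by
    intro v hv
    rw [Function.iterate_succ_apply', hparent v _ le_rfl _ le_rfl, Nat.sub_self,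
      Function.iterate_zero_apply]
  have hlen : ∀ v ≠ r, height G r v + 1 ≤ G.dist (path v).1 r := by
    intro v hv
    have h1 := hdepth v hv _ le_rfl
    have h2 := hT.connected.pos_dist_of_ne hv
    change _ ≤ G.dist (c^[height G r v] v) r
    omega
  have hdist : ∀ v ≠ r, G.dist (path v).1 (path v).2 = height G r v + 1 := by
    intro v hv
    change G.dist (path v).1 (parent G r v) = _
    rw [hend v hv]
    exact dist_iterate_parent hT (hlen v hv)
  have hmem : ∀ u ≠ r, ∃ v, top v ∧ ∃ m ≤ height G r v, u = c^[m] v := by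
    intro u
    generalize hd : G.dist u r = d
    induction d generalizing u with
    | zero => intro hu; exact absurd (hT.connected.dist_eq_zero_iff.1 hd) hu
    | succ d ih =>
      intro hu
      by_cases htop : top u
      · exact ⟨u, htop, 0, Nat.zero_le _, rfl⟩
      · obtain ⟨hpr, hcu⟩ : parent G r u ≠ r ∧ c (parent G r u) = u := by
          by_contra h
          exact htop ⟨hu, h⟩
        have h1 := dist_parent hT hu
        obtain ⟨v, hv, m, hm, hpm⟩ := ih (parent G r u) (by omega) hpr
        have h2 := hheight v m hm
        have h3 := height_add_one_le_height_parent hT hu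
        rw [← hpm] at h2
        refine ⟨v, hv, m + 1, by omega, ?_⟩
        rw [Function.iterate_succ_apply', ← hpm, hcu]
  have hunique : ∀ v v', top v → top v' → ∀ m ≤ height G r v, ∀ m' ≤ height G r v',
      m ≤ m' → c^[m] v = c^[m'] v' → v = v' := by
    intro v v' hv hv' m hm m' hm' hmm h
    have h1 := hparent v m hm m le_rfl
    rw [h, hparent v' m' hm' m hmm, Nat.sub_self, Function.iterate_zero_apply] at h1
    obtain hk | ⟨k, hk⟩ : m' - m = 0 ∨ ∃ k, m' - m = k + 1 := by
      cases m' - m with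
      | zero => exact Or.inl rfl
      | succ k => exact Or.inr ⟨k, rfl⟩
    · rw [hk] at h1
      exact h1.symm
    · rw [hk, Function.iterate_succ_apply'] at h1
      have h2 := hheight v' k (by omega)
      have h3 := hcp (c^[k] v') (by omega)
      rw [h1] at h3
      exact absurd ⟨h3 ▸ hroot v' hv'.1 k (by omega), h3 ▸ h1⟩ hv.2
  have hunique' : ∀ v v', top v → top v' → ∀ m ≤ height G r v, ∀ m' ≤ height G r v',
      c^[m] v = c^[m'] v' → v = v' := by
    intro v v' hv hv' m hm m' hm' h
    rcases le_total m m' with hmm | hmm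
    · exact hunique v v' hv hv' m hm m' hm' hmm h
    · exact (hunique v' v hv' hv m' hm' m hm hmm h.symm).symm
  have hinj : Set.InjOn path (univ.filter top : Finset V) := by
    intro v hv v' hv' h
    rw [mem_coe, mem_filter] at hv hv'
    exact hunique' v v' hv.2 hv'.2 _ le_rfl _ le_rfl (congrArg Prod.fst h)
  refine ⟨(univ.filter top).image path, (isPathPartition_iff hT).2 ⟨?_, ?_, ?_⟩, ?_⟩
  · intro p hp heq
    obtain ⟨v, hv, rfl⟩ := mem_image.1 hp
    have := hdist v (mem_filter.1 hv).2.1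
    rw [heq, SimpleGraph.dist_self] at this
    omega
  · intro p hp
    obtain ⟨v, hv, rfl⟩ := mem_image.1 hp
    have hvr := (mem_filter.1 hv).2.1
    change IsRootward G r (path v).1 (parent G r v)
    rw [hend v hvr]
    exact isRootward_iterate_parent hT (hlen v hvr)
  · intro u hu
    obtain ⟨v, hv, m, hm, hum⟩ := hmem u hu
    refine ⟨path v, ⟨mem_image_of_mem _ (mem_filter.2 ⟨mem_univ _, hv⟩), height G r v - m, ?_, ?_⟩,
      ?_⟩
    · rw [hdist v hv.1]
      omega
    · rw [hparent v _ le_rfl _ (Nat.sub_le _ _), Nat.sub_sub_self hm, hum]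
    · rintro p ⟨hp, j, hj, huj⟩
      obtain ⟨v', hv', rfl⟩ := mem_image.1 hp
      replace hv' := (mem_filter.1 hv').2
      rw [hdist v' hv'.1] at hj
      rw [hparent v' _ le_rfl _ (by omega)] at huj
      rw [hunique' v' v hv' hv _ (Nat.sub_le _ _) m hm (huj.symm.trans hum)]
  · intro s hs
    rw [sum_image hinj]
    have hsum : ∑ v with top v, (2 ^ G.dist (path v).1 (path v).2 - 1) =
        ∑ v ∈ s with top v, (2 ^ (height G r v + 1) - 1) := by
      refine sum_congr ?_ fun v hv => ?_
      · ext v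
        simp only [mem_filter, mem_univ, true_and, hs]
        exact ⟨fun h => ⟨h.1, h⟩, fun h => h.2⟩
      · rw [hdist v ((hs v).1 (mem_filter.1 hv).1)]
    rw [hsum]
    have hsplit := sum_filter_add_sum_filter_not s top (fun v => 2 ^ (height G r v + 1) - 1)
    have htotal : ∑ v ∈ s, (2 ^ (height G r v + 1) - 1) =
        ∑ v ∈ s, 2 ^ height G r v + ∑ v ∈ s, (2 ^ height G r v - 1) := by
      rw [← sum_add_distrib]
      refine sum_congr rfl fun v _ => ?_
      have := Nat.one_le_two_pow (n := height G r v)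
      rw [pow_succ]
      omega
    have hnot : ∀ v ∈ s.filter (fun v => ¬ top v),
        v ≠ r ∧ parent G r v ≠ r ∧ c (parent G r v) = v := by
      intro v hv
      obtain ⟨h1, h2⟩ := mem_filter.1 hv
      refine ⟨(hs v).1 h1, ?_⟩
      by_contra h
      exact h2 ⟨(hs v).1 h1, h⟩
    have hbound : ∑ v ∈ s with ¬ top v, (2 ^ (height G r v + 1) - 1) ≤
        ∑ v ∈ s, (2 ^ height G r v - 1) := by
      calc ∑ v ∈ s with ¬ top v, (2 ^ (height G r v + 1) - 1)
          ≤ ∑ v ∈ s with ¬ top v, (2 ^ height G r (parent G r v) - 1) :=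
            sum_le_sum fun v hv => Nat.sub_le_sub_right (Nat.pow_le_pow_right two_pos
              (height_add_one_le_height_parent hT (hnot v hv).1)) 1
        _ = ∑ u ∈ (s.filter fun v => ¬ top v).image (parent G r), (2 ^ height G r u - 1) := by
            rw [sum_image]
            intro v hv v' hv' h
            rw [← (hnot v hv).2.2, ← (hnot v' hv').2.2, h]
        _ ≤ ∑ v ∈ s, (2 ^ height G r v - 1) := by
            refine sum_le_sum_of_subset fun u hu => ?_
            obtain ⟨v, hv, rfl⟩ := mem_image.1 hu
            exact (hs _).2 (hnot v hv).2.1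
    omega

/-- The pebbling number is one more than the size of a largest unsolvable configuration. -/
lemma piVertex_eq_add_one {N : ℕ} {C : V → ℕ} (hC : ∑ v, C v = N)
    (hns : ¬ PebblingSolvable G r C)
    (hs : ∀ D : V → ℕ, ∑ v, D v = N + 1 → PebblingSolvable G r D) :
    piVertex G r = N + 1 := by
  refine le_antisymm (Nat.sInf_le hs) (le_csInf ⟨_, hs⟩ fun t ht => ?_)
  by_contra! hlt
  obtain ⟨D, hDC, hD⟩ : ∃ D : V → ℕ, D ≤ C ∧ ∑ v, D v = t := by
    have hle : t ≤ ∑ v, C v := by omega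
    clear hs hns ht hlt
    subst hC
    induction hle using Nat.decreasingInduction with
    | self => exact ⟨C, le_rfl, rfl⟩
    | of_succ t _ ih =>
      classical
      obtain ⟨D, hDC, hD⟩ := ih
      obtain ⟨u, -, hu⟩ := exists_ne_zero_of_sum_ne_zero (s := univ) (f := D) (by omega)
      refine ⟨Function.update D u (D u - 1), fun x => ?_, ?_⟩
      · refine le_trans ?_ (hDC x)
        by_cases hx : x = u
        · subst hx
          simp
        · simp [hx]
      · rw [sum_update_of_mem (mem_univ u)]
        rw [sum_eq_add_sum_sdiff_singleton_of_mem (mem_univ u)] at hD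
        omega
  exact hns ((ht D hD).mono hDC)

end PathPartition

/-- **Chung's formula** for the pebbling number of a tree: if `𝒫` is a maximum
path partition of the tree `G` rooted at `r`, then
`π(G,r) = ∑_{P ∈ 𝒫} 2^{e_P} − |𝒫| + 1`. -/
theorem tree_pebbling_number [Fintype V] (G : SimpleGraph V) (hT : G.IsTree) (r : V)
    (P : Finset (V × V)) (hP : IsPathPartition G r P)
    (hmax : ∀ Q : Finset (V × V), IsPathPartition G r Q →
      Majorizes (P.val.map fun p => G.dist p.1 p.2) (Q.val.map fun p => G.dist p.1 p.2)) :
    piVertex G r = (∑ p ∈ P, 2 ^ (G.dist p.1 p.2)) - P.card + 1 := by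
  classical
  obtain ⟨C, hC, hns⟩ := hP.exists_not_pebblingSolvable hT
  obtain ⟨Q, hQ, hweight⟩ := exists_isPathPartition_weight (r := r) hT
  have hQP : ∑ p ∈ Q, (2 ^ G.dist p.1 p.2 - 1) ≤ ∑ p ∈ P, (2 ^ G.dist p.1 p.2 - 1) := by
    have h := (hmax Q hQ).sum_two_pow_sub_one_le
    rw [Multiset.map_map, Multiset.map_map] at h
    exact h
  have hcard : (∑ p ∈ P, 2 ^ G.dist p.1 p.2) - P.card = ∑ p ∈ P, (2 ^ G.dist p.1 p.2 - 1) := by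
    rw [sum_tsub_distrib _ fun p _ => Nat.one_le_two_pow, card_eq_sum_ones]
  rw [hcard]
  refine piVertex_eq_add_one hC hns fun D hD => pebblingSolvable_of_lt_weight hT ?_
  calc ∑ v with v ≠ r, 2 ^ height G r v
      ≤ ∑ p ∈ P, (2 ^ G.dist p.1 p.2 - 1) := (hweight _ fun v => by simp).trans hQP
    _ < ∑ v, D v := by omega
    _ ≤ ∑ v, 2 ^ height G r v * D v :=
      sum_le_sum fun v _ => Nat.le_mul_of_pos_left _ (by positivity)
end

section
/- Let G be a connected simple graph with root vertex r, and let (T,w) be a nonbasic strategy rooted at r. Then there exist finitely many (basic) strategies (T_1,w_1), …, (T_k,w_k) rooted at r, with each T_i a subtree of T, and nonnegative rationals c_1, …, c_k, such that w(v) = ∑_{i=1}^k c_i·w_i(v) for every vertex v of G. -/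
open Finset SimpleGraph

variable {V : Type*}

/-- A nonbasic strategy: as a basic strategy, except that the parent condition
`w(v⁺) = 2·w(v)` is relaxed to the inequality `w(v⁺) ≥ 2·w(v)`. -/
structure NonbasicStrategy (G : SimpleGraph V) (r : V) where
  T : G.Subgraph
  w : V → ℚ
  root_mem : r ∈ T.verts
  two_le_ncard : 2 ≤ T.verts.ncard
  isTree : T.coe.IsTree
  w_nonneg : ∀ v, 0 ≤ w v
  w_ne_zero : w ≠ 0
  w_outside : ∀ v, v ∉ T.verts → w v = 0
  w_root : w r = 0
  w_parent : ∀ u v : T.verts, T.coe.Adj u v → (v : V) ≠ r → ¬ T.Adj r (v : V) →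
    T.coe.dist u ⟨r, root_mem⟩ < T.coe.dist v ⟨r, root_mem⟩ → 2 * w (v : V) ≤ w (u : V)

namespace SimpleGraph.Subgraph

variable {G : SimpleGraph V} {T : G.Subgraph} {r : V}

open Classical in
/-- The distance to `r` inside the subgraph `T`, and `0` for vertices outside `T`. -/
noncomputable def depth (T : G.Subgraph) (hr : r ∈ T.verts) (v : V) : ℕ :=
  if h : v ∈ T.verts then T.coe.dist ⟨v, h⟩ ⟨r, hr⟩ else 0

theorem depth_coe (hr : r ∈ T.verts) (v : T.verts) :
    T.depth hr v = T.coe.dist v ⟨r, hr⟩ := by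
  simp [depth]

theorem depth_eq_succ_of_lt (hr : r ∈ T.verts) (hT : T.coe.Connected) {u v : T.verts}
    (h : T.coe.Adj u v) (hlt : T.depth hr u < T.depth hr v) :
    T.depth hr v = T.depth hr u + 1 := by
  rw [depth_coe, depth_coe] at *
  have h1 := hT.dist_triangle (u := v) (v := u) (w := ⟨r, hr⟩)
  have h2 : T.coe.dist v u = 1 := dist_eq_one_iff_adj.mpr h.symm
  omega

variable {S : Set V}

/-- A set of vertices together with `r` spans a subgraph with the same distances to `r`,
provided that the set is closed under taking neighbors nearer to `r`. -/
theorem exists_walk_induce_length_le (hr : r ∈ T.verts) (hT : T.coe.Connected)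
    (hST : S ⊆ T.verts)
    (hclosed : ∀ u v : T.verts, T.coe.Adj u v → (v : V) ∈ S →
      T.depth hr u < T.depth hr v → (u : V) ≠ r → (u : V) ∈ S)
    (v : V) (hv : v ∈ (T.induce (insert r S)).verts) :
    ∃ p : (T.induce (insert r S)).coe.Walk ⟨v, hv⟩ ⟨r, Set.mem_insert r S⟩,
      p.length ≤ T.depth hr v := by
  induction hn : T.depth hr v using Nat.strong_induction_on generalizing v with
  | _ n ih =>
    by_cases hvr : v = r
    · subst hvr
      exact ⟨Walk.nil, by simp⟩
    have hvS : v ∈ S := hv.resolve_left hvr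
    have hvT : v ∈ T.verts := hST hvS
    obtain ⟨p, hp⟩ := hT.exists_walk_length_eq_dist ⟨v, hvT⟩ ⟨r, hr⟩
    rw [← depth_coe hr ⟨v, hvT⟩] at hp
    cases p with
    | nil => exact absurd rfl hvr
    | @cons _ u _ h q =>
      have hlt : T.depth hr u < T.depth hr v := by
        have := dist_le q
        rw [← depth_coe] at this
        simp only [Walk.length_cons] at hp
        omega
      have hu : (u : V) ∈ insert r S := by
        by_cases hur : (u : V) = r
        · exact Or.inl hur
        · exact Or.inr (hclosed u ⟨v, hvT⟩ h.symm hvS hlt hur)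
      obtain ⟨q', hq'⟩ := ih _ (hn ▸ hlt) u hu rfl
      have hadj : (T.induce (insert r S)).coe.Adj ⟨v, hv⟩ ⟨u, hu⟩ := ⟨hv, hu, h⟩
      refine ⟨Walk.cons hadj q', ?_⟩
      simp only [Walk.length_cons]
      omega

end SimpleGraph.Subgraph

open SimpleGraph.Subgraph

theorem exists_strategy_of_parentClosed {G : SimpleGraph V} {r : V} {T : G.Subgraph}
    (hr : r ∈ T.verts) (hT : T.coe.IsTree) {S : Set V} (hfin : S.Finite) (hne : S.Nonempty)
    (hST : S ⊆ T.verts) (hrS : r ∉ S)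
    (hclosed : ∀ u v : T.verts, T.coe.Adj u v → (v : V) ∈ S →
      T.depth hr u < T.depth hr v → (u : V) ≠ r → (u : V) ∈ S) :
    ∃ X : Strategy G r, X.T ≤ T ∧ X.w = S.indicator fun v => (1 / 2) ^ T.depth hr v := by
  have hsub : insert r S ⊆ T.verts := Set.insert_subset hr hST
  have hle : T.induce (insert r S) ≤ T :=
    (induce_mono_right hsub).trans (by simp)
  have hwalk := exists_walk_induce_length_le hr hT.connected hST hclosed
  have hrT : r ∈ (T.induce (insert r S)).verts := Set.mem_insert r S
  have hdist (v : (T.induce (insert r S)).verts) :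
      (T.induce (insert r S)).coe.dist v ⟨r, hrT⟩ = T.depth hr v := by
    obtain ⟨p, hp⟩ := hwalk v v.2
    refine le_antisymm ((dist_le p).trans hp) ?_
    obtain ⟨q, hq⟩ := p.reachable.exists_walk_length_eq_dist
    rw [← hq, ← Walk.length_map (inclusion hle) q]
    exact (depth_coe hr _).le.trans (dist_le (q.map (inclusion hle)))
  refine ⟨{ T := T.induce (insert r S)
            w := S.indicator fun v => (1 / 2) ^ T.depth hr v
            root_mem := hrT
            two_le_ncard := ?_
            isTree := ⟨?_, hT.isAcyclic.comap (inclusion hle) (inclusion.injective hle)⟩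
            w_nonneg := fun v => Set.indicator_nonneg (fun _ _ => by positivity) v
            w_ne_zero := ?_
            w_outside := fun v hv => Set.indicator_of_notMem (fun h => hv (Or.inr h)) _
            w_root := Set.indicator_of_notMem hrS _
            w_parent := ?_ }, hle, rfl⟩
  · have h1 : (insert r S).ncard = S.ncard + 1 := Set.ncard_insert_of_notMem hrS hfin
    have h2 : 0 < S.ncard := (Set.ncard_pos hfin).mpr hne
    rw [induce_verts]
    omega
  · refine (connected_iff_exists_forall_reachable _).mpr ⟨⟨r, hrT⟩, fun v => ?_⟩
    exact (hwalk v v.2).choose.reachable.symm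
  · obtain ⟨v, hv⟩ := hne
    intro h
    have := congrFun h v
    simp [Set.indicator_of_mem hv] at this
  · intro u v huv hvr hadj hlt
    rw [hdist, hdist] at hlt
    have hur : (u : V) ≠ r := by
      intro h
      have hu : u = ⟨r, hrT⟩ := Subtype.ext h
      subst hu
      exact hadj huv
    have hd : T.depth hr v = T.depth hr u + 1 :=
      depth_eq_succ_of_lt hr hT.connected ((inclusion hle).map_adj huv) hlt
    rw [Set.indicator_of_mem (u.2.resolve_left hur), Set.indicator_of_mem (v.2.resolve_left hvr),
      hd, pow_succ]
    ring

/-- A function that decreases away from `r`, rescaled by the depth, is a conic combination of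
strategies, one for each of its superlevel sets. -/
theorem exists_conic_combination_of_antitone {G : SimpleGraph V} {r : V} {T : G.Subgraph}
    (hr : r ∈ T.verts) (hT : T.coe.IsTree) (hfin : T.verts.Finite) (f : V → ℚ)
    (hf0 : ∀ v, 0 ≤ f v) (hout : ∀ v, v ∉ T.verts → f v = 0) (hroot : f r = 0)
    (hmono : ∀ u v : T.verts, T.coe.Adj u v → T.depth hr u < T.depth hr v →
      (u : V) ≠ r → f v ≤ f u) :
    ∃ (k : ℕ) (S : Fin k → Strategy G r) (c : Fin k → ℚ),
      (∀ i, 0 ≤ c i) ∧ (∀ i, (S i).T ≤ T) ∧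
      ∀ v : V, (1 / 2) ^ T.depth hr v * f v = ∑ i, c i * (S i).w v := by
  have hsupp (g : V → ℚ) (hg : ∀ v, v ∉ T.verts → g v = 0) : g.support ⊆ T.verts :=
    fun v hv => by_contra fun h => hv (hg v h)
  induction hn : f.support.ncard using Nat.strong_induction_on generalizing f with
  | _ n ih =>
    have hSfin : f.support.Finite := hfin.subset (hsupp f hout)
    rcases f.support.eq_empty_or_nonempty with hS | hS
    · rw [Function.support_eq_empty_iff] at hS
      exact ⟨0, Fin.elim0, Fin.elim0, fun i => i.elim0, fun i => i.elim0, by simp [hS]⟩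
    obtain ⟨m, hm, hmin⟩ := Set.exists_min_image _ f hSfin hS
    have hfm : 0 < f m := lt_of_le_of_ne (hf0 m) (Ne.symm hm)
    have hclosed (u v : T.verts) (huv : T.coe.Adj u v) (hv : (v : V) ∈ f.support)
        (hlt : T.depth hr u < T.depth hr v) (hur : (u : V) ≠ r) : (u : V) ∈ f.support :=
      (((hf0 v).lt_of_ne (Ne.symm hv)).trans_le (hmono u v huv hlt hur)).ne'
    obtain ⟨X, hXT, hXw⟩ := exists_strategy_of_parentClosed hr hT hSfin hS (hsupp f hout)
      (by simpa using hroot) hclosed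
    have hg (v : V) : 0 ≤ f v - f.support.indicator (fun _ => f m) v := by
      by_cases hv : v ∈ f.support
      · simpa [Set.indicator_of_mem hv] using hmin v hv
      · simpa [Set.indicator_of_notMem hv] using hf0 v
    have hg0 (v : V) (hv : f v = 0) : f v - f.support.indicator (fun _ => f m) v = 0 := by
      simp [hv]
    have hcard : (fun v => f v - f.support.indicator (fun _ => f m) v).support.ncard < n := by
      rw [← hn]
      refine Set.ncard_lt_ncard (Set.ssubset_iff_exists.mpr ⟨fun v hv hv0 => ?_, m, hm, ?_⟩) hSfin
      · exact hv (hg0 v hv0)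
      · simp [Set.indicator_of_mem hm]
    have hgmono (u v : T.verts) (huv : T.coe.Adj u v) (hlt : T.depth hr u < T.depth hr v)
        (hur : (u : V) ≠ r) : f v - f.support.indicator (fun _ => f m) v ≤
          f u - f.support.indicator (fun _ => f m) u := by
      by_cases hv : (v : V) ∈ f.support
      · simpa [Set.indicator_of_mem hv, Set.indicator_of_mem (hclosed u v huv hv hlt hur)]
          using hmono u v huv hlt hur
      · simpa only [hg0 v (Function.notMem_support.mp hv)] using hg u
    obtain ⟨k, S, c, hc, hST, hsum⟩ := ih _ hcard
      (fun v => f v - f.support.indicator (fun _ => f m) v) hg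
      (fun v hv => hg0 v (hout v hv)) (hg0 r hroot) hgmono rfl
    refine ⟨k + 1, Fin.cons X S, Fin.cons (f m) c, ?_, ?_, fun v => ?_⟩
    · exact Fin.cases hfm.le hc
    · exact Fin.cases hXT hST
    · rw [Fin.sum_univ_succ]
      simp only [Fin.cons_zero, Fin.cons_succ, ← hsum v, hXw]
      by_cases hv : v ∈ f.support
      · simp only [Set.indicator_of_mem hv]
        ring
      · simp only [Set.indicator_of_notMem hv]
        ring

/-- Every nonbasic strategy is a conic combination of basic strategies whose
trees are subtrees of its tree. -/
theorem nonbasic_strategy_conic_combination (G : SimpleGraph V) (hG : G.Connected) (r : V)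
    (N : NonbasicStrategy G r) :
    ∃ (k : ℕ) (S : Fin k → Strategy G r) (c : Fin k → ℚ),
      (∀ i, 0 ≤ c i) ∧ (∀ i, (S i).T ≤ N.T) ∧
      ∀ v : V, N.w v = ∑ i, c i * (S i).w v := by
  have hfin : N.T.verts.Finite := Set.finite_of_ncard_pos (by have := N.two_le_ncard; omega)
  have hcancel (v : V) : (1 / 2 : ℚ) ^ N.T.depth N.root_mem v *
      (2 ^ N.T.depth N.root_mem v * N.w v) = N.w v := by
    rw [← mul_assoc, ← mul_pow]
    norm_num
  have hmono (u v : N.T.verts) (huv : N.T.coe.Adj u v)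
      (hlt : N.T.depth N.root_mem u < N.T.depth N.root_mem v) (hur : (u : V) ≠ r) :
      2 ^ N.T.depth N.root_mem v * N.w v ≤ 2 ^ N.T.depth N.root_mem u * N.w u := by
    have hd := depth_eq_succ_of_lt N.root_mem N.isTree.connected huv hlt
    have hvr : (v : V) ≠ r := by
      intro h
      have hv : v = ⟨r, N.root_mem⟩ := Subtype.ext h
      rw [depth_coe, depth_coe, hv, dist_self] at hlt
      omega
    have hadj : ¬ N.T.Adj r v := by
      intro h
      have hv : N.T.coe.dist v ⟨r, N.root_mem⟩ = 1 := dist_eq_one_iff_adj.mpr h.symm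
      rw [depth_coe, depth_coe] at hlt
      have hu : N.T.coe.dist u ⟨r, N.root_mem⟩ = 0 := by omega
      exact hur (congrArg Subtype.val (N.isTree.connected.dist_eq_zero_iff.mp hu))
    have h2 := N.w_parent u v huv hvr hadj (by rwa [depth_coe, depth_coe] at hlt)
    simp only [hd, pow_succ, mul_assoc]
    exact mul_le_mul_of_nonneg_left h2 (by positivity)
  obtain ⟨k, S, c, hc, hST, hsum⟩ := exists_conic_combination_of_antitone N.root_mem N.isTree hfin
    (fun v => 2 ^ N.T.depth N.root_mem v * N.w v)
    (fun v => mul_nonneg (by positivity) (N.w_nonneg v))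
    (fun v hv => by simp [N.w_outside v hv]) (by simp [N.w_root]) hmono
  exact ⟨k, S, c, hc, hST, fun v => by rw [← hsum v, hcancel]⟩
end

section
/- Let P_n be the path with vertices v_1, v_2, …, v_n (n ≥ 2), where v_i is adjacent to v_{i+1}. A configuration C on P_n is v_1-unsolvable if and only if C(v_1) = 0 and ∑_{j=2}^{n} 2^{n−j}·C(v_j) ≤ 2^{n−1} − 1. -/
open Finset SimpleGraph

variable {V : Type*}

theorem PebblingMove.exists_add_ite_eq [DecidableEq V] {G : SimpleGraph V} {C C' : V → ℕ}
    (h : PebblingMove G C C') :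
    ∃ u v : V, G.Adj u v ∧
      ∀ x, C' x + (if x = u then 2 else 0) = C x + (if x = v then 1 else 0) := by
  obtain ⟨u, v, hadj, h2, hu, hv, hx⟩ := h
  refine ⟨u, v, hadj, fun x => ?_⟩
  have hne := hadj.ne
  by_cases hxu : x = u
  · subst hxu
    simp only [if_true, if_neg hne]
    omega
  · by_cases hxv : x = v
    · subst hxv
      simp [hxu, hv]
    · simp [hxu, hxv, hx x hxu hxv]

theorem sum_mul_add_eq_of_add_ite_eq [Fintype V] [DecidableEq V] {C C' : V → ℕ} {u v : V}
    (h : ∀ x, C' x + (if x = u then 2 else 0) = C x + (if x = v then 1 else 0)) (f : V → ℕ) :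
    ∑ x, f x * C' x + f u * 2 = ∑ x, f x * C x + f v := by
  have key : ∑ x, f x * (C' x + (if x = u then 2 else 0)) =
      ∑ x, f x * (C x + (if x = v then 1 else 0)) :=
    Finset.sum_congr rfl fun x _ => by rw [h x]
  simpa [mul_add, Finset.sum_add_distrib] using key

theorem exists_pebblingMove [DecidableEq V] {G : SimpleGraph V} {C : V → ℕ} {u v : V}
    (hadj : G.Adj u v) (h2 : 2 ≤ C u) :
    ∃ C' : V → ℕ, PebblingMove G C C' ∧
      ∀ x, C' x + (if x = u then 2 else 0) = C x + (if x = v then 1 else 0) := by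
  have hne := hadj.ne
  refine ⟨fun x => C x - (if x = u then 2 else 0) + (if x = v then 1 else 0),
    ⟨u, v, hadj, h2, ?_, ?_, ?_⟩, ?_⟩
  · simp [hne]
  · simp [hne.symm]
  · intro x hxu hxv
    simp [hxu, hxv]
  · intro x
    by_cases hxu : x = u
    · subst hxu
      simp only [if_true, if_neg hne]
      omega
    · simp [hxu]

/-- A weight that at most doubles along each edge does not increase under pebbling moves. -/
theorem sum_mul_le_of_reflTransGen [Fintype V] {G : SimpleGraph V} {f : V → ℕ}
    (hf : ∀ u v, G.Adj u v → f v ≤ 2 * f u) {C C' : V → ℕ}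
    (h : Relation.ReflTransGen (PebblingMove G) C C') :
    ∑ x, f x * C' x ≤ ∑ x, f x * C x := by
  classical
  induction h with
  | refl => exact le_rfl
  | tail _ hmove ih =>
    obtain ⟨u, v, hadj, hx⟩ := hmove.exists_add_ite_eq
    have := sum_mul_add_eq_of_add_ite_eq hx f
    have := hf u v hadj
    omega

theorem sum_two_pow_mul_lt {m : ℕ} {C : Fin (m + 1) → ℕ} (h0 : C 0 = 0) (h1 : ∀ j, C j ≤ 1) :
    ∑ j : Fin (m + 1), 2 ^ (m - (j : ℕ)) * C j < 2 ^ m := by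
  have hle : ∑ j : Fin m, 2 ^ (m - ((j.succ : Fin (m + 1)) : ℕ)) * C j.succ ≤
      ∑ j : Fin m, 2 ^ (m - 1 - (j : ℕ)) := by
    refine Finset.sum_le_sum fun j _ => ?_
    rw [Fin.val_succ, Nat.sub_add_eq, Nat.sub_right_comm]
    exact mul_le_of_le_one_right (Nat.zero_le _) (h1 j.succ)
  have hgeom : ∑ j : Fin m, 2 ^ (m - 1 - (j : ℕ)) = 2 ^ m - 1 := by
    rw [Fin.sum_univ_eq_sum_range (fun j => 2 ^ (m - 1 - j)) m,
      Finset.sum_range_reflect (fun j => 2 ^ j) m, Nat.geomSum_eq le_rfl]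
    simp
  have := Nat.two_pow_pos m
  rw [Fin.sum_univ_succ, h0, mul_zero, zero_add]
  omega

theorem pebblingSolvable_pathGraph_of_le {m : ℕ} (C : Fin (m + 1) → ℕ)
    (h : 2 ^ m ≤ ∑ j : Fin (m + 1), 2 ^ (m - (j : ℕ)) * C j) :
    PebblingSolvable (SimpleGraph.pathGraph (m + 1)) 0 C := by
  induction hs : ∑ j, C j using Nat.strong_induction_on generalizing C with
  | _ s ih =>
    by_cases h0 : C 0 = 0
    · obtain ⟨u, hu⟩ : ∃ u, 2 ≤ C u := by
        by_contra! hlt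
        exact (sum_two_pow_mul_lt h0 fun j => Nat.le_of_lt_succ (hlt j)).not_ge h
      obtain ⟨i, rfl⟩ : ∃ i : Fin m, u = i.succ :=
        ⟨u.pred (by rintro rfl; omega), by simp⟩
      have hadj : (SimpleGraph.pathGraph (m + 1)).Adj i.succ i.castSucc := by
        simp [SimpleGraph.pathGraph_adj]
      obtain ⟨C', hmove, hx⟩ := exists_pebblingMove hadj hu
      have hsize := sum_mul_add_eq_of_add_ite_eq hx fun _ => 1
      have hweight := sum_mul_add_eq_of_add_ite_eq hx fun j => 2 ^ (m - (j : ℕ))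
      have hpow : 2 ^ (m - (i.castSucc : ℕ)) = 2 ^ (m - (i.succ : ℕ)) * 2 := by
        rw [← pow_succ]
        congr 1
        simp only [Fin.val_castSucc, Fin.val_succ]
        omega
      simp only [one_mul] at hsize
      obtain ⟨D, hD, hroot⟩ := ih (∑ j, C' j) (by omega) C' (by omega) rfl
      exact ⟨D, .head hmove hD, hroot⟩
    · exact ⟨C, .refl, Nat.one_le_iff_ne_zero.mpr h0⟩

theorem pebblingSolvable_pathGraph_iff {m : ℕ} (C : Fin (m + 1) → ℕ) :
    PebblingSolvable (SimpleGraph.pathGraph (m + 1)) 0 C ↔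
      2 ^ m ≤ ∑ j : Fin (m + 1), 2 ^ (m - (j : ℕ)) * C j := by
  refine ⟨fun ⟨D, hD, hroot⟩ => ?_, pebblingSolvable_pathGraph_of_le C⟩
  refine le_trans ?_ (sum_mul_le_of_reflTransGen (fun u v hadj => ?_) hD)
  · calc 2 ^ m ≤ 2 ^ (m - ((0 : Fin (m + 1)) : ℕ)) * D 0 := Nat.le_mul_of_pos_right _ hroot
      _ ≤ _ := Finset.single_le_sum (f := fun j : Fin (m + 1) => 2 ^ (m - (j : ℕ)) * D j)
          (fun _ _ => Nat.zero_le _) (Finset.mem_univ _)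
  · rw [← pow_succ']
    rw [SimpleGraph.pathGraph_adj] at hadj
    exact Nat.pow_le_pow_right two_pos (by omega)

/-- On the path `P_n` with vertices `v_1, …, v_n` (here indexed `0, …, n-1`),
a configuration is `v_1`-unsolvable iff `C(v_1) = 0` and
`∑_{j=2}^n 2^{n-j}·C(v_j) ≤ 2^{n-1} - 1`. -/
theorem path_unsolvable_iff (n : ℕ) (hn : 2 ≤ n) (C : Fin n → ℕ) :
    ¬ PebblingSolvable (SimpleGraph.pathGraph n) ⟨0, by omega⟩ C ↔
      (C ⟨0, by omega⟩ = 0 ∧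
        ∑ j ∈ Finset.univ.filter (fun j : Fin n => (j : ℕ) ≠ 0),
          2 ^ (n - 1 - (j : ℕ)) * C j ≤ 2 ^ (n - 1) - 1) := by
  obtain ⟨m, rfl⟩ : ∃ m, n = m + 1 := ⟨n - 1, by omega⟩
  have hfilter : (Finset.univ.filter fun j : Fin (m + 1) => (j : ℕ) ≠ 0) =
      Finset.univ.erase 0 := by
    ext j
    simp only [Finset.mem_filter, Finset.mem_erase, Finset.mem_univ, true_and, and_true, ne_eq,
      Fin.val_eq_zero_iff]
  have hsplit := Finset.add_sum_erase Finset.univ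
    (fun j : Fin (m + 1) => 2 ^ (m - (j : ℕ)) * C j) (Finset.mem_univ 0)
  have hpos := Nat.two_pow_pos m
  rw [hfilter, Nat.add_sub_cancel]
  change ¬ PebblingSolvable (SimpleGraph.pathGraph (m + 1)) 0 C ↔ C 0 = 0 ∧ _
  rw [pebblingSolvable_pathGraph_iff, ← hsplit, not_le]
  rw [show m - ((0 : Fin (m + 1)) : ℕ) = m from rfl]
  constructor
  · intro h
    have h0 : C 0 = 0 := by
      by_contra hne
      have := Nat.le_mul_of_pos_right (2 ^ m) (Nat.pos_of_ne_zero hne)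
      omega
    rw [h0] at h
    exact ⟨h0, by omega⟩
  · rintro ⟨h0, h⟩
    rw [h0]
    omega
end

section
/- Let L be the Lemke graph. For every vertex r of L with r ≠ v_1, we have π(L,r) ≤ 8. -/
open Finset SimpleGraph

variable {V : Type*}

/-- The edges of the Lemke graph, with `v_i` represented by `i - 1 : Fin 8`. -/
def lemkeEdges : List (Fin 8 × Fin 8) :=
  [(0,1), (0,2), (1,3), (2,4), (2,5), (2,6), (3,4), (3,5), (3,6), (3,7),
   (4,7), (5,7), (6,7)]

/-- The Lemke graph. -/
def lemkeGraph : SimpleGraph (Fin 8) :=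
  SimpleGraph.fromRel (fun i j => (i, j) ∈ lemkeEdges)

lemma PebblingMove.solvable {G : SimpleGraph V} {r : V} {C C' : V → ℕ} (hmove : PebblingMove G C C')
    (h : PebblingSolvable G r C') : PebblingSolvable G r C := by
  obtain ⟨D, hD, hr⟩ := h
  exact ⟨D, .head hmove hD, hr⟩

/-- The weight function lemma, for trees given by a parent function `p` and weights that at least
double from each vertex to its parent: an `r`-unsolvable configuration has weight at most that of
the configuration with one pebble on every vertex. -/
theorem sum_weight_mul_le_of_not_solvable [Fintype V] {G : SimpleGraph V} {r : V}
    (p : V → V) (w : V → ℕ)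
    (hw : ∀ v, w v ≠ 0 → G.Adj v (p v) ∧ (p v = r ∨ 2 * w v ≤ w (p v)))
    {C : V → ℕ} (hC : ¬ PebblingSolvable G r C) :
    ∑ v, w v * C v ≤ ∑ v, w v := by
  classical
  induction hn : ∑ v, C v using Nat.strong_induction_on generalizing C with
  | _ n ih =>
    by_contra! hlt
    obtain ⟨v, -, hv⟩ := Finset.exists_lt_of_sum_lt hlt
    have hwv : w v ≠ 0 := by rintro h; simp [h] at hv
    have hCv : 2 ≤ C v := by
      by_contra! h
      have : w v * C v ≤ w v * 1 := Nat.mul_le_mul_left _ (by omega)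
      omega
    obtain ⟨hadj, hpar⟩ := hw v hwv
    let C' : V → ℕ := fun x => C x - 2 * Pi.single (M := fun _ => ℕ) v 1 x
      + Pi.single (M := fun _ => ℕ) (p v) 1 x
    have hne : p v ≠ v := hadj.ne'
    have hmove : PebblingMove G C C' :=
      ⟨v, p v, hadj, hCv, by simp [C', hne.symm], by simp [C', hne],
        fun x hx hx' => by simp [C', hx, hx']⟩
    have hC' : ¬ PebblingSolvable G r C' := fun h => hC (hmove.solvable h)
    have hpr : p v ≠ r := by
      rintro rfl
      exact hC' ⟨C', .refl, by simp [C']⟩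
    have hbal : ∀ x, C' x + 2 * Pi.single (M := fun _ => ℕ) v 1 x
        = C x + Pi.single (M := fun _ => ℕ) (p v) 1 x := by
      intro x
      rcases eq_or_ne x v with rfl | hx
      · simp [C', hne.symm]; omega
      · simp [C', hx]
    have hsize : ∑ x, C' x + 2 = ∑ x, C x + 1 := by
      simpa [Finset.sum_add_distrib, ← Finset.mul_sum]
        using Finset.sum_congr (rfl : Finset.univ = _) fun x _ => hbal x
    have hweight : ∑ x, w x * C' x + 2 * w v = ∑ x, w x * C x + w (p v) := by
      have := Finset.sum_congr (rfl : Finset.univ = _) fun x _ => congrArg (w x * ·) (hbal x)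
      simpa [mul_add, Finset.sum_add_distrib, Pi.single_apply, mul_comm] using this
    have := ih _ (by omega) hC' rfl
    have := hpar.resolve_left hpr
    omega

lemma piVertex_le_of_forall_solvable [Fintype V] {G : SimpleGraph V} {r : V} {t : ℕ}
    (h : ∀ C : V → ℕ, ∑ v, C v = t → PebblingSolvable G r C) : piVertex G r ≤ t :=
  Nat.sInf_le h

instance : DecidableRel lemkeGraph.Adj :=
  inferInstanceAs (DecidableRel (SimpleGraph.fromRel fun i j => (i, j) ∈ lemkeEdges).Adj)

/-- For every vertex `r ≠ v_1` of the Lemke graph, `π(L,r) ≤ 8`. -/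
theorem lemke_piVertex_le (r : Fin 8) (hr : r ≠ 0) : piVertex lemkeGraph r ≤ 8 := by
  refine piVertex_le_of_forall_solvable fun C hC => ?_
  by_contra hns
  have hroot : C r = 0 := by
    by_contra h
    exact hns ⟨C, .refl, Nat.one_le_iff_ne_zero.2 h⟩
  have bound := fun p w hw => sum_weight_mul_le_of_not_solvable p w hw hns
  simp only [Fin.sum_univ_eight] at hC bound
  -- `bound p w` takes the parents and the weights; parents of vertices of weight 0 are arbitrary.
  fin_cases r
  · exact hr rfl
  · have h₁ := bound ![0, 0, 4, 1, 3, 3, 3, 3] ![0, 0, 3, 12, 6, 5, 5, 6] (by decide)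
    have h₂ := bound ![1, 0, 0, 0, 2, 2, 2, 5] ![8, 0, 4, 0, 1, 2, 2, 1] (by decide)
    simp at h₁ h₂ hroot
    omega
  · have h₁ := bound ![2, 0, 0, 0, 0, 0, 0, 0] ![2, 1, 0, 0, 0, 0, 0, 0] (by decide)
    have h₂ := bound ![0, 3, 0, 4, 2, 0, 0, 4] ![0, 1, 0, 2, 4, 0, 0, 2] (by decide)
    have h₃ := bound ![0, 3, 0, 5, 0, 2, 0, 5] ![0, 1, 0, 2, 0, 4, 0, 2] (by decide)
    have h₄ := bound ![0, 0, 0, 0, 0, 0, 2, 0] ![0, 0, 0, 0, 0, 0, 1, 0] (by decide)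
    simp at h₁ h₂ h₃ h₄ hroot
    omega
  · have h₁ := bound ![1, 3, 0, 0, 0, 0, 0, 0] ![1, 2, 0, 0, 0, 0, 0, 0] (by decide)
    have h₂ := bound ![2, 0, 4, 0, 3, 0, 0, 0] ![1, 0, 2, 0, 4, 0, 0, 0] (by decide)
    have h₃ := bound ![2, 0, 5, 0, 0, 3, 0, 0] ![1, 0, 2, 0, 0, 4, 0, 0] (by decide)
    have h₄ := bound ![0, 0, 0, 0, 0, 0, 3, 3] ![0, 0, 0, 0, 0, 0, 1, 1] (by decide)
    simp at h₁ h₂ h₃ h₄ hroot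
    omega
  · have h₁ := bound ![2, 0, 4, 0, 0, 2, 2, 6] ![2, 1, 4, 0, 0, 1, 2, 1] (by decide)
    have h₂ := bound ![1, 3, 0, 4, 0, 3, 3, 3] ![1, 2, 0, 4, 0, 2, 1, 2] (by decide)
    simp at h₁ h₂ hroot
    omega
  · have h₁ := bound ![2, 0, 5, 0, 2, 0, 2, 6] ![2, 1, 4, 0, 1, 0, 2, 1] (by decide)
    have h₂ := bound ![1, 3, 0, 5, 3, 0, 3, 3] ![1, 2, 0, 4, 2, 0, 1, 2] (by decide)
    simp at h₁ h₂ hroot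
    omega
  · have h₁ := bound ![2, 0, 6, 0, 2, 2, 0, 5] ![2, 1, 4, 0, 1, 2, 0, 1] (by decide)
    have h₂ := bound ![1, 3, 0, 6, 3, 3, 0, 3] ![1, 2, 0, 4, 2, 1, 0, 2] (by decide)
    simp at h₁ h₂ hroot
    omega
  · have h₁ := bound ![1, 3, 0, 7, 0, 0, 0, 0] ![1, 2, 0, 4, 0, 0, 0, 0] (by decide)
    have h₂ := bound ![2, 0, 4, 0, 7, 2, 0, 0] ![2, 1, 4, 0, 8, 1, 0, 0] (by decide)
    have h₃ := bound ![2, 0, 5, 0, 0, 7, 2, 0] ![2, 1, 4, 0, 0, 8, 1, 0] (by decide)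
    have h₄ := bound ![2, 0, 6, 0, 2, 0, 7, 0] ![2, 1, 4, 0, 1, 0, 8, 0] (by decide)
    simp at h₁ h₂ h₃ h₄ hroot
    omega
end

section
/- Let B_4 be the fourth weak Bruhat graph. Then π(B_4) ≤ 72. -/
open Finset SimpleGraph

variable {V : Type*}

/-- The fourth weak Bruhat graph: the Cayley graph of `S_4` generated by the
adjacent transpositions `(1 2)`, `(2 3)`, `(3 4)`. -/
def bruhatGraph : SimpleGraph (Equiv.Perm (Fin 4)) :=
  SimpleGraph.fromRel (fun σ τ => ∃ i : Fin 3, τ = σ * Equiv.swap i.castSucc i.succ)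

/-- Weight function lemma: if every vertex `v` of positive weight has a neighbor which is the root
or weighs at least twice as much as `v`, then a configuration weighing more than the one with a
single pebble on each vertex is solvable. -/
theorem pebblingSolvable_of_weight [Fintype V] [DecidableEq V] {G : SimpleGraph V} {r : V}
    {w : V → ℕ} (hw : ∀ v, w v ≠ 0 → ∃ u, G.Adj v u ∧ (u = r ∨ 2 * w v ≤ w u)) (C : V → ℕ)
    (hC : ∑ v, w v < ∑ v, w v * C v) : PebblingSolvable G r C := by
  induction hn : ∑ v, C v using Nat.strong_induction_on generalizing C with
  | _ n ih =>
    obtain ⟨v, -, hv⟩ := Finset.exists_lt_of_sum_lt hC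
    have hwv : w v ≠ 0 := by rintro h; simp [h] at hv
    have hCv : 2 ≤ C v := by
      by_contra! h
      exact absurd (Nat.mul_le_mul_left (w v) (Nat.le_of_lt_succ h)) (by simpa using hv)
    obtain ⟨u, hvu, hu⟩ := hw v hwv
    have hne : u ≠ v := hvu.ne'
    let C' : V → ℕ := fun x => if x = v then C v - 2 else if x = u then C u + 1 else C x
    have hmove : PebblingMove G C C' :=
      ⟨v, u, hvu, hCv, by simp [C'], by simp [C', hne],
        fun x hxv hxu => by simp [C', hxv, hxu]⟩
    rcases hu with rfl | hu
    · exact ⟨C', .single hmove, by simp [C', hne]⟩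
    have hsum (f : V → ℕ) : ∑ x, f x * C' x + 2 * f v = ∑ x, f x * C x + f u := by
      have h : ∀ x, f x * C' x + (if x = v then 2 * f x else 0) =
          f x * C x + (if x = u then f x else 0) := by
        intro x
        by_cases hxv : x = v
        · subst hxv
          obtain ⟨k, hk⟩ := Nat.exists_eq_add_of_le hCv
          simp only [C', if_true, if_neg hne.symm, hk, Nat.add_sub_cancel_left]
          ring
        · by_cases hxu : x = u
          · subst hxu
            simp [C', hxv]
            ring
          · simp [C', hxv, hxu]
      simpa [Finset.sum_add_distrib] using Finset.sum_congr (rfl : univ = univ) fun x _ => h x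
    have hsize := hsum 1
    have hweight := hsum w
    simp only [Pi.one_apply, one_mul] at hsize
    obtain ⟨D, hD, hDr⟩ := ih _ (by omega) C' (by omega) rfl
    exact ⟨D, .head hmove hD, hDr⟩

theorem bruhatGraph_adj_mul_swap (σ : Equiv.Perm (Fin 4)) (i : Fin 3) :
    bruhatGraph.Adj σ (σ * Equiv.swap i.castSucc i.succ) := by
  rw [bruhatGraph, SimpleGraph.fromRel_adj]
  exact ⟨by simp [Fin.ext_iff], Or.inl ⟨i, rfl⟩⟩

/-- A function on permutations of `Fin 4`, tabulated by their words `σ 0, σ 1, σ 2, σ 3` and zero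
at the words that are not listed. -/
def tabulated (L : List (List (Fin 4) × ℕ)) (σ : Equiv.Perm (Fin 4)) : ℕ :=
  (L.lookup [σ 0, σ 1, σ 2, σ 3]).getD 0

/-- The weights of five strategies for `bruhatGraph` rooted at the identity. -/
def bruhatWeight : Fin 5 → Equiv.Perm (Fin 4) → ℕ := ![
  tabulated [([0, 1, 3, 2], 64), ([1, 0, 3, 2], 32), ([1, 3, 0, 2], 16), ([1, 0, 2, 3], 16),
    ([1, 3, 2, 0], 8), ([1, 2, 0, 3], 8), ([3, 1, 2, 0], 4), ([2, 1, 0, 3], 4),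
    ([3, 2, 1, 0], 2), ([2, 1, 3, 0], 2), ([2, 3, 1, 0], 1)],
  tabulated [([0, 2, 1, 3], 64), ([0, 2, 3, 1], 32), ([2, 0, 3, 1], 16), ([0, 3, 2, 1], 16),
    ([2, 3, 0, 1], 8), ([2, 3, 1, 0], 4), ([3, 2, 0, 1], 4), ([3, 2, 1, 0], 2)],
  tabulated [([0, 2, 1, 3], 64), ([2, 0, 1, 3], 32), ([2, 1, 0, 3], 16), ([1, 2, 0, 3], 8),
    ([2, 1, 3, 0], 8), ([1, 0, 2, 3], 4), ([2, 3, 1, 0], 4), ([1, 0, 3, 2], 2),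
    ([3, 2, 1, 0], 2), ([1, 3, 0, 2], 1), ([3, 1, 2, 0], 1)],
  tabulated [([0, 1, 3, 2], 64), ([0, 3, 1, 2], 32), ([3, 0, 1, 2], 16), ([3, 1, 0, 2], 8),
    ([3, 0, 2, 1], 8), ([3, 1, 2, 0], 4), ([3, 2, 0, 1], 4), ([3, 2, 1, 0], 2),
    ([2, 3, 1, 0], 1)],
  tabulated [([1, 0, 2, 3], 64), ([1, 2, 0, 3], 32), ([1, 2, 3, 0], 16), ([2, 1, 3, 0], 8),
    ([1, 3, 2, 0], 8), ([3, 1, 2, 0], 4), ([3, 2, 1, 0], 2)]]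

theorem bruhatWeight_neighbor : ∀ k σ, bruhatWeight k σ ≠ 0 → ∃ i : Fin 3,
    σ * Equiv.swap i.castSucc i.succ = 1 ∨
      2 * bruhatWeight k σ ≤ bruhatWeight k (σ * Equiv.swap i.castSucc i.succ) := by
  decide +kernel

theorem sum_bruhatWeight : ∑ σ, ∑ k, ![1, 2, 1, 2, 1] k * bruhatWeight k σ = 1003 := by
  decide +kernel

theorem le_sum_bruhatWeight :
    ∀ σ ≠ 1, 14 ≤ ∑ k, ![1, 2, 1, 2, 1] k * bruhatWeight k σ := by
  decide +kernel

theorem bruhatGraph_pebblingSolvable (r : Equiv.Perm (Fin 4)) (C : Equiv.Perm (Fin 4) → ℕ)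
    (hC : ∑ σ, C σ = 72) : PebblingSolvable bruhatGraph r C := by
  by_contra hns
  have hCr : C r = 0 := by
    by_contra h
    exact hns ⟨C, .refl, Nat.one_le_iff_ne_zero.mpr h⟩
  have hle (k : Fin 5) :
      ∑ σ, bruhatWeight k (r⁻¹ * σ) * C σ ≤ ∑ σ, bruhatWeight k σ := by
    rw [← Equiv.sum_comp (Equiv.mulLeft r⁻¹) (bruhatWeight k)]
    by_contra! h
    refine hns (pebblingSolvable_of_weight (fun σ hσ => ?_) C h)
    obtain ⟨i, hi⟩ := bruhatWeight_neighbor k (r⁻¹ * σ) hσ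
    refine ⟨_, bruhatGraph_adj_mul_swap σ i, hi.imp (fun h => ?_) fun h => ?_⟩
    · rwa [mul_assoc, inv_mul_eq_one, eq_comm] at h
    · simpa [mul_assoc] using h
  have hlower : 14 * ∑ σ, C σ ≤
      ∑ σ, (∑ k, ![1, 2, 1, 2, 1] k * bruhatWeight k (r⁻¹ * σ)) * C σ := by
    rw [Finset.mul_sum]
    refine Finset.sum_le_sum fun σ _ => ?_
    by_cases h : σ = r
    · simp [h, hCr]
    · exact Nat.mul_le_mul_right _
        (le_sum_bruhatWeight _ fun h' => h (inv_mul_eq_one.mp h').symm)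
  have hupper : ∑ σ, (∑ k, ![1, 2, 1, 2, 1] k * bruhatWeight k (r⁻¹ * σ)) * C σ ≤ 1003 := by
    rw [← sum_bruhatWeight, Finset.sum_comm]
    simp_rw [Finset.sum_mul]
    rw [Finset.sum_comm]
    refine Finset.sum_le_sum fun k _ => ?_
    simp_rw [mul_assoc, ← Finset.mul_sum]
    exact Nat.mul_le_mul_left _ (hle k)
  omega

/-- `π(B_4) ≤ 72`. -/
theorem bruhat_pebbling_number_le : pebblingNumber bruhatGraph ≤ 72 :=
  Finset.sup_le fun r _ => Nat.sInf_le (bruhatGraph_pebblingSolvable r)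
end
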